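/- For every spherical Coxeter system (W̄,S) there exists a constant k ∈ ℝ⁺, depending only on (W̄,S), with the following property: for every ℝ-building (Λ,F) of type (W̄,S), every chamber at infinity C_∞, and all points β, γ ∈ Λ, there exists a point δ ∈ Λ such that the sector C_δ is a subsector of both C_β and C_γ, and d(β,δ) ≤ k·d(β,γ) and d(γ,δ) ≤ k·d(β,γ). -/

import Mathlib

open Set

noncomputable section

/-- The model space `𝔸`: Euclidean `n`-space. -/
abbrev ModelSpace (n : ℕ) : Type := EuclideanSpace ℝ (Fin n)

/-- A linear reflection of the model space: an involutive isometry, different from the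
identity, whose fixed-point set is a linear hyperplane (the kernel of a nonzero linear
functional). -/
def IsLinearReflection {n : ℕ} (s : ModelSpace n ≃ᵢ ModelSpace n) : Prop :=
  s * s = 1 ∧ s ≠ 1 ∧
    ∃ p : ModelSpace n →ₗ[ℝ] ℝ, p ≠ 0 ∧ {x | s x = x} = {x | p x = 0}

/-- A spherical Coxeter system of rank `n`, realized as a finite reflection group acting
on the model space `ℝⁿ`: a finite set `S` of linear reflections generating a finite
group `W̄`. -/
structure SphericalCoxeterSystem (n : ℕ) where
  S : Set (ModelSpace n ≃ᵢ ModelSpace n)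
  finiteS : S.Finite
  refl : ∀ s ∈ S, IsLinearReflection s
  finiteW : Finite ↥(Subgroup.closure S)

namespace SphericalCoxeterSystem

variable {n : ℕ}

/-- The finite reflection group `W̄` generated by `S`. -/
def Wbar (cs : SphericalCoxeterSystem n) : Subgroup (ModelSpace n ≃ᵢ ModelSpace n) :=
  Subgroup.closure cs.S

/-- A translation of the model space. -/
def IsTranslation (t : ModelSpace n ≃ᵢ ModelSpace n) : Prop :=
  ∃ v : ModelSpace n, ∀ x, t x = x + v

/-- The group `W` of affine transformations generated by `W̄` and all translations. -/
def W (cs : SphericalCoxeterSystem n) : Subgroup (ModelSpace n ≃ᵢ ModelSpace n) :=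
  Subgroup.closure (cs.S ∪ {t | IsTranslation t})

/-- An affine reflection: a `W`-conjugate of a generator in `S`. -/
def IsAffineReflection (cs : SphericalCoxeterSystem n)
    (r : ModelSpace n ≃ᵢ ModelSpace n) : Prop :=
  ∃ s ∈ cs.S, ∃ w ∈ cs.W, r = w * s * w⁻¹

/-- A wall of the model space: the fixed-point set of an affine reflection. -/
def IsModelWall (cs : SphericalCoxeterSystem n) (M : Set (ModelSpace n)) : Prop :=
  ∃ r, cs.IsAffineReflection r ∧ M = {x | r x = x}

/-- A half-apartment of the model space: a closed half-space `H` bounded by the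
wall `M` (fixed-point set of the affine reflection `r`). -/
def IsModelHalf (cs : SphericalCoxeterSystem n) (M H : Set (ModelSpace n)) : Prop :=
  ∃ r, cs.IsAffineReflection r ∧ M = {x | r x = x} ∧
    IsClosed H ∧ Convex ℝ H ∧ H ∪ (⇑r '' H) = univ ∧ H ∩ (⇑r '' H) = M

/-- A sector-face of the model space based at `x`: a closed cell of the arrangement of
all walls through `x` (for each wall through `x` one chooses either the wall itself or
one of its two half-apartments, and takes the intersection of the choices). -/
def IsModelSectorFace (cs : SphericalCoxeterSystem n) (x : ModelSpace n)
    (F : Set (ModelSpace n)) : Prop :=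
  F.Nonempty ∧ ∃ σ : Set (ModelSpace n) → Set (ModelSpace n),
    (∀ M, cs.IsModelWall M → x ∈ M → (σ M = M ∨ cs.IsModelHalf M (σ M))) ∧
    F = ⋂ M ∈ {M | cs.IsModelWall M ∧ x ∈ M}, σ M

/-- A sector of the model space based at `x`: a maximal sector-face based at `x`. -/
def IsModelSector (cs : SphericalCoxeterSystem n) (x : ModelSpace n)
    (F : Set (ModelSpace n)) : Prop :=
  cs.IsModelSectorFace x F ∧ ∀ F', cs.IsModelSectorFace x F' → F ⊆ F' → F' = F

/-- A sector-panel of the model space based at `x`: a sector-face of codimension one. -/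
def IsModelSectorPanel (cs : SphericalCoxeterSystem n) (x : ModelSpace n)
    (F : Set (ModelSpace n)) : Prop :=
  cs.IsModelSectorFace x F ∧ Module.finrank ℝ (affineSpan ℝ F).direction = n - 1

/-- The word length on `W̄` with respect to the generating set `S`. -/
def wordLength (cs : SphericalCoxeterSystem n) (w : ModelSpace n ≃ᵢ ModelSpace n) : ℕ :=
  sInf {k | ∃ l : List (ModelSpace n ≃ᵢ ModelSpace n),
    l.length = k ∧ (∀ s ∈ l, s ∈ cs.S) ∧ l.prod = w}

/-- The longest element of `W̄`. -/
def IsLongest (cs : SphericalCoxeterSystem n) (w : ModelSpace n ≃ᵢ ModelSpace n) : Prop :=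
  w ∈ cs.Wbar ∧ ∀ v ∈ cs.Wbar, cs.wordLength v ≤ cs.wordLength w

end SphericalCoxeterSystem

section Building

variable {n : ℕ} {X : Type*} [MetricSpace X]

/-- Two subsets of a metric space are parallel if their Hausdorff distance is finite. -/
def Par (S T : Set X) : Prop := EMetric.hausdorffEdist S T ≠ ⊤

/-- Two sets locally coincide at `α` (have the same germ at `α`) if their intersection
is a neighbourhood of `α` in both of them. -/
def LocCoin (α : X) (F F' : Set X) : Prop :=
  F ∩ F' ∈ nhdsWithin α F ∧ F ∩ F' ∈ nhdsWithin α F'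

variable (cs : SphericalCoxeterSystem n)

/-- An apartment: the image of a chart. -/
def IsApartment (Fc : Set (ModelSpace n → X)) (A : Set X) : Prop :=
  ∃ f ∈ Fc, A = range f

/-- A sector-face based at `α` : the image under a chart of a sector-face of the model
space, with base point mapped to `α`. -/
def IsSectorFaceAt (Fc : Set (ModelSpace n → X)) (α : X) (F : Set X) : Prop :=
  ∃ f ∈ Fc, ∃ x s, cs.IsModelSectorFace x s ∧ f x = α ∧ F = f '' s

/-- A sector based at `α`. -/
def IsSectorAt (Fc : Set (ModelSpace n → X)) (α : X) (F : Set X) : Prop :=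
  ∃ f ∈ Fc, ∃ x s, cs.IsModelSector x s ∧ f x = α ∧ F = f '' s

/-- A sector-panel based at `α`. -/
def IsSectorPanelAt (Fc : Set (ModelSpace n → X)) (α : X) (F : Set X) : Prop :=
  ∃ f ∈ Fc, ∃ x s, cs.IsModelSectorPanel x s ∧ f x = α ∧ F = f '' s

/-- A sector-face. -/
def IsSectorFace (Fc : Set (ModelSpace n → X)) (F : Set X) : Prop :=
  ∃ α, IsSectorFaceAt cs Fc α F

/-- A sector. -/
def IsSector (Fc : Set (ModelSpace n → X)) (F : Set X) : Prop :=
  ∃ α, IsSectorAt cs Fc α F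

/-- A sector-panel. -/
def IsSectorPanel (Fc : Set (ModelSpace n → X)) (F : Set X) : Prop :=
  ∃ α, IsSectorPanelAt cs Fc α F

/-- A wall: the image of a wall of the model space under a chart. -/
def IsWall (Fc : Set (ModelSpace n → X)) (M : Set X) : Prop :=
  ∃ f ∈ Fc, ∃ m, cs.IsModelWall m ∧ M = f '' m

/-- A half-apartment: the image of a half-apartment of the model space under a chart. -/
def IsHalfApartment (Fc : Set (ModelSpace n → X)) (H : Set X) : Prop :=
  ∃ f ∈ Fc, ∃ m h, cs.IsModelHalf m h ∧ H = f '' h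

/-- An ℝ-building of type `(W̄,S)` with set of points `Λ` inside the ambient metric
space `X` (taking `Λ` a subset of an ambient metric space makes it possible to speak of
one ℝ-building being contained in another): a set of isometric charts from the model
space satisfying the axioms (A1)–(A5). -/
structure RBuilding (cs : SphericalCoxeterSystem n) (X : Type*) [MetricSpace X]
    (Λ : Set X) : Type _ where
  charts : Set (ModelSpace n → X)
  isom : ∀ f ∈ charts, Isometry f
  into : ∀ f ∈ charts, range f ⊆ Λ
  A1 : ∀ f ∈ charts, ∀ w ∈ cs.W, (f ∘ ⇑w) ∈ charts
  A2 : ∀ f ∈ charts, ∀ g ∈ charts,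
        IsClosed {x | f x ∈ range g} ∧ Convex ℝ {x | f x ∈ range g} ∧
        ∃ w ∈ cs.W, ∀ x, f x ∈ range g → f x = g (w x)
  A3 : ∀ p ∈ Λ, ∀ q ∈ Λ, ∃ f ∈ charts, p ∈ range f ∧ q ∈ range f
  A4 : ∀ S₁ S₂, IsSector cs charts S₁ → IsSector cs charts S₂ →
        ∃ T₁ T₂ f, f ∈ charts ∧ IsSector cs charts T₁ ∧ IsSector cs charts T₂ ∧
          T₁ ⊆ S₁ ∧ T₂ ⊆ S₂ ∧ T₁ ⊆ range f ∧ T₂ ⊆ range f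
  A5 : ∀ f₁ ∈ charts, ∀ f₂ ∈ charts, ∀ f₃ ∈ charts,
        IsHalfApartment cs charts (range f₁ ∩ range f₂) →
        IsHalfApartment cs charts (range f₂ ∩ range f₃) →
        IsHalfApartment cs charts (range f₁ ∩ range f₃) →
        (range f₁ ∩ range f₂ ∩ range f₃).Nonempty

/-- The Weyl distance, inside the apartment given by the chart `f`, from the sector `S`
to the sector `S'` (both contained in that apartment): the element `w ∈ W̄` mapping the
sector of the model space based at the origin parallel to `f⁻¹(S)` to the one parallel
to `f⁻¹(S')`. -/
def WeylDistIn (f : ModelSpace n → X) (S S' : Set X)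
    (w : ModelSpace n ≃ᵢ ModelSpace n) : Prop :=
  w ∈ cs.Wbar ∧ ∃ s s', cs.IsModelSector 0 s ∧ cs.IsModelSector 0 s' ∧
    Par (f '' s) S ∧ Par (f '' s') S' ∧ ⇑w '' s = s'

/-- `w` is the Weyl distance from the germ at `α` of the sector `S` to the germ at `α`
of the sector `S'` (both based at `α`): computed via sectors based at `α` with the same
germs lying in a common apartment. -/
def GermWeylDist (Fc : Set (ModelSpace n → X)) (α : X) (S S' : Set X)
    (w : ModelSpace n ≃ᵢ ModelSpace n) : Prop :=
  ∃ f ∈ Fc, ∃ T T', IsSectorAt cs Fc α T ∧ IsSectorAt cs Fc α T' ∧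
    T ⊆ range f ∧ T' ⊆ range f ∧ LocCoin α S T ∧ LocCoin α S' T' ∧
    WeylDistIn cs f T T' w

/-- `w` is the Weyl distance between the chambers at infinity represented by the
sectors `S` and `S'`: computed via parallel sectors lying in a common apartment. -/
def ChamberWeylDist (Fc : Set (ModelSpace n → X)) (S S' : Set X)
    (w : ModelSpace n ≃ᵢ ModelSpace n) : Prop :=
  ∃ f ∈ Fc, ∃ T T', IsSector cs Fc T ∧ IsSector cs Fc T' ∧
    T ⊆ range f ∧ T' ⊆ range f ∧ Par T S ∧ Par T' S' ∧ WeylDistIn cs f T T' w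

/-- The germs at `α` of two sectors based at `α` are opposite if their Weyl distance is
the longest element of `W̄`. -/
def OppositeGerms (Fc : Set (ModelSpace n → X)) (α : X) (S S' : Set X) : Prop :=
  ∃ w, GermWeylDist cs Fc α S S' w ∧ cs.IsLongest w

/-- Two chambers at infinity (represented by the sectors `C`, `D`) are adjacent if they
are distinct and their Weyl distance lies in `S`. -/
def AdjacentChambers (Fc : Set (ModelSpace n → X)) (C D : Set X) : Prop :=
  ¬ Par C D ∧ ∃ s ∈ cs.S, ChamberWeylDist cs Fc C D s

/-- Two sector-panels are asymptotic if they contain a common subset which is itself a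
sector-panel. -/
def Asymptotic (Fc : Set (ModelSpace n → X)) (P P' : Set X) : Prop :=
  ∃ Q, IsSectorPanel cs Fc Q ∧ Q ⊆ P ∧ Q ⊆ P'

/-- An automorphism of an ℝ-building: an isometry `g` of `Λ` with `g ∘ f` a chart for
every chart `f`. -/
def RBuilding.IsAuto {Λ : Set X} (B : RBuilding cs X Λ) (g : ↥Λ ≃ᵢ ↥Λ) : Prop :=
  ∀ f (hf : f ∈ B.charts),
    (fun a : ModelSpace n =>
      ((g ⟨f a, B.into f hf (mem_range_self a)⟩ : ↥Λ) : X)) ∈ B.charts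

end Building

section CAT0

/-- `G` is a geodesic segment from `x` to `y`: an isometric image of a closed real
interval with endpoints `x` and `y`. -/
def IsGeodesicSegment {Y : Type*} [MetricSpace Y] (x y : Y) (G : Set Y) : Prop :=
  ∃ (a b : ℝ) (γ : ℝ → Y), a ≤ b ∧ γ a = x ∧ γ b = y ∧
    (∀ s ∈ Set.Icc a b, ∀ t ∈ Set.Icc a b, dist (γ s) (γ t) = |s - t|) ∧
    G = γ '' Set.Icc a b

/-- A CAT(0) space: a geodesic metric space in which every geodesic triangle satisfies
the CAT(0) comparison inequality with respect to comparison triangles in the Euclidean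
plane. -/
def IsCAT0Space (Y : Type*) [MetricSpace Y] : Prop :=
  (∀ x y : Y, ∃ G, IsGeodesicSegment x y G) ∧
  ∀ (x y z : Y) (G : Set Y), IsGeodesicSegment x y G → ∀ a ∈ G,
    ∀ x' y' z' : EuclideanSpace ℝ (Fin 2),
      dist x' y' = dist x y → dist y' z' = dist y z → dist x' z' = dist x z →
      ∀ a' ∈ segment ℝ x' y', dist x' a' = dist x a → dist z a ≤ dist z' a'

end CAT0

open Filter Topology

namespace SphericalCoxeterSystem

variable {n : ℕ} (cs : SphericalCoxeterSystem n)

/-- A linear isometry belongs to `W̄`. -/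
def IsLin (L : ModelSpace n ≃ₗᵢ[ℝ] ModelSpace n) : Prop := L.toIsometryEquiv ∈ cs.Wbar

/-- The unit roots: unit normal vectors of the reflections of `W̄` conjugate to a generator. -/
def roots : Set (ModelSpace n) :=
  {a | ‖a‖ = 1 ∧ ∃ s ∈ cs.S, ∃ w ∈ cs.Wbar, ∀ x, (w * s * w⁻¹) x = x - (2 * inner ℝ a x) • a}

/-- The linear reflection in the hyperplane orthogonal to `a`. -/
def reflIn (a : ModelSpace n) : ModelSpace n ≃ₗᵢ[ℝ] ModelSpace n := (ℝ ∙ a)ᗮ.reflection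

variable {cs}

lemma reflIn_apply {a : ModelSpace n} (ha : ‖a‖ = 1) (x : ModelSpace n) :
    reflIn a x = x - (2 * inner ℝ a x) • a := by
  rw [reflIn, Submodule.reflection_orthogonal_apply, Submodule.reflection_singleton_apply, ha]
  simp [two_mul, add_smul, two_smul]

lemma reflIn_reflIn (a x : ModelSpace n) : reflIn a (reflIn a x) = x :=
  Submodule.reflection_reflection _ _

lemma reflIn_neg (a x : ModelSpace n) : reflIn (-a) x = reflIn a x := by
  have : (ℝ ∙ (-a)) = (ℝ ∙ a) := by simpa using Submodule.span_neg ({a} : Set (ModelSpace n))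
  simp only [reflIn, this]

lemma reflIn_of_orthogonal {a x : ModelSpace n} (ha : ‖a‖ = 1) (h : inner ℝ a x = 0) :
    reflIn a x = x := by
  rw [reflIn_apply ha, h]; simp

lemma inner_reflIn {a : ModelSpace n} (ha : ‖a‖ = 1) (x : ModelSpace n) :
    inner ℝ a (reflIn a x) = - inner ℝ a x := by
  rw [reflIn_apply ha, inner_sub_right, inner_smul_right, real_inner_self_eq_norm_sq, ha]; ring

lemma inner_reflIn_left (a x y : ModelSpace n) :
    inner ℝ (reflIn a x) y = inner ℝ x (reflIn a y) := by
  rw [← LinearIsometryEquiv.inner_map_map (reflIn a) x (reflIn a y), reflIn_reflIn]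

lemma exists_linear_of_map_zero (w : ModelSpace n ≃ᵢ ModelSpace n) (h : w 0 = 0) :
    ∃ L : ModelSpace n ≃ₗᵢ[ℝ] ModelSpace n, L.toIsometryEquiv = w :=
  ⟨w.toRealLinearIsometryEquivOfMapZero h, by ext1 x; rfl⟩

lemma map_zero_of_mem_Wbar {w : ModelSpace n ≃ᵢ ModelSpace n} (hw : w ∈ cs.Wbar) : w 0 = 0 := by
  induction hw using Subgroup.closure_induction with
  | mem s hs =>
    obtain ⟨-, -, p, -, hp⟩ := cs.refl s hs
    have : (0 : ModelSpace n) ∈ {x | p x = 0} := by simp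
    rw [← hp] at this
    exact this
  | one => rfl
  | mul x y _ _ hx hy => rw [IsometryEquiv.mul_apply, hy, hx]
  | inv x _ hx => exact (x.toEquiv.symm_apply_eq).2 hx.symm

lemma exists_isLin_of_mem_Wbar {w : ModelSpace n ≃ᵢ ModelSpace n} (hw : w ∈ cs.Wbar) :
    ∃ L : ModelSpace n ≃ₗᵢ[ℝ] ModelSpace n, cs.IsLin L ∧ ∀ x, w x = L x := by
  obtain ⟨L, hL⟩ := exists_linear_of_map_zero w (map_zero_of_mem_Wbar hw)
  exact ⟨L, by rw [IsLin, hL]; exact hw, fun x => by rw [← hL]; rfl⟩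

lemma IsLin.symm {L : ModelSpace n ≃ₗᵢ[ℝ] ModelSpace n} (h : cs.IsLin L) : cs.IsLin L.symm :=
  cs.Wbar.inv_mem h

lemma IsLin.trans {L M : ModelSpace n ≃ₗᵢ[ℝ] ModelSpace n} (h : cs.IsLin L) (h' : cs.IsLin M) :
    cs.IsLin (L.trans M) :=
  cs.Wbar.mul_mem h' h

lemma isLin_refl : cs.IsLin (LinearIsometryEquiv.refl ℝ (ModelSpace n)) :=
  cs.Wbar.one_mem

lemma Wbar_le_W : cs.Wbar ≤ cs.W := Subgroup.closure_mono subset_union_left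

lemma exists_affine_of_mem_W {w : ModelSpace n ≃ᵢ ModelSpace n} (hw : w ∈ cs.W) :
    ∃ L : ModelSpace n ≃ₗᵢ[ℝ] ModelSpace n, cs.IsLin L ∧ ∃ b, ∀ x, w x = L x + b := by
  induction hw using Subgroup.closure_induction with
  | mem s hs =>
    rcases hs with hs | ⟨v, hv⟩
    · obtain ⟨L, hL, h⟩ := exists_isLin_of_mem_Wbar (Subgroup.subset_closure hs : s ∈ cs.Wbar)
      exact ⟨L, hL, 0, by simpa using h⟩
    · exact ⟨_, isLin_refl, v, hv⟩
  | one => exact ⟨_, isLin_refl, 0, fun x => by simp⟩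
  | mul x y _ _ hx hy =>
    obtain ⟨L, hL, b, h⟩ := hx
    obtain ⟨M, hM, c, h'⟩ := hy
    refine ⟨_, hM.trans hL, L c + b, fun z => ?_⟩
    rw [IsometryEquiv.mul_apply, h, h', map_add, add_assoc]; rfl
  | inv x _ hx =>
    obtain ⟨L, hL, b, h⟩ := hx
    refine ⟨_, hL.symm, -(L.symm b), fun z => ?_⟩
    refine (x.toEquiv.symm_apply_eq).2 ?_
    change z = x _
    rw [h]; simp

lemma affine_mem_W {L : ModelSpace n ≃ₗᵢ[ℝ] ModelSpace n} (hL : cs.IsLin L) (b : ModelSpace n) :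
    L.toIsometryEquiv.trans (IsometryEquiv.addRight b) ∈ cs.W := by
  have h : IsometryEquiv.addRight b ∈ cs.W :=
    Subgroup.subset_closure (Or.inr ⟨b, fun x => rfl⟩)
  exact cs.W.mul_mem h (Wbar_le_W hL)

/-- A linear isometry fixing a hyperplane is trivial or the reflection in this hyperplane. -/
lemma eq_id_or_reflIn {a : ModelSpace n} (ha : ‖a‖ = 1) (L : ModelSpace n ≃ₗᵢ[ℝ] ModelSpace n)
    (h : ∀ x, inner ℝ a x = 0 → L x = x) : (∀ x, L x = x) ∨ ∀ x, L x = reflIn a x := by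
  have haa : inner ℝ a a = (1 : ℝ) := by rw [real_inner_self_eq_norm_sq, ha]; norm_num
  have hdec : ∀ x : ModelSpace n, L x = x - (inner ℝ a x : ℝ) • a + (inner ℝ a x : ℝ) • L a := by
    intro x
    have h1 : inner ℝ a (x - (inner ℝ a x : ℝ) • a) = (0 : ℝ) := by
      rw [inner_sub_right, inner_smul_right, haa]; ring
    have h2 := h _ h1
    rw [map_sub, map_smul] at h2
    rw [← h2]; abel
  set c : ℝ := inner ℝ a (L a) with hc
  have hLa : L a = c • a := by
    have h1 : inner ℝ a (L a - c • a) = (0 : ℝ) := by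
      rw [inner_sub_right, inner_smul_right, haa]; simp [hc]
    have h2 : inner ℝ (L a - c • a) (L a) = (0 : ℝ) := by
      rw [← h _ h1, LinearIsometryEquiv.inner_map_map, real_inner_comm, h1]
    have h3 : inner ℝ (L a - c • a) (L a - c • a) = (0 : ℝ) := by
      rw [inner_sub_right, h2, inner_smul_right, real_inner_comm, h1]; simp
    exact sub_eq_zero.1 (inner_self_eq_zero.1 h3)
  have hc2 : |c| = 1 := by
    have := L.norm_map a
    rw [hLa, norm_smul, ha] at this
    simpa using this
  rcases eq_or_eq_neg_of_abs_eq hc2 with h1 | h1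
  · left; intro x; rw [hdec, hLa, h1]; simp
  · right; intro x; rw [hdec, hLa, h1, reflIn_apply ha, two_mul, add_smul]; simp; abel

lemma exists_unit_normal {s : ModelSpace n ≃ᵢ ModelSpace n} (hs : IsLinearReflection s) :
    ∃ a : ModelSpace n, ‖a‖ = 1 ∧ ∀ x, s x = reflIn a x := by
  obtain ⟨-, hne, p, hp0, hp⟩ := hs
  have h0 : s 0 = 0 := by
    have : (0 : ModelSpace n) ∈ {x | p x = 0} := by simp
    rw [← hp] at this
    exact this
  obtain ⟨L, rfl⟩ := exists_linear_of_map_zero s h0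
  set b := (InnerProductSpace.toDual ℝ (ModelSpace n)).symm (LinearMap.toContinuousLinearMap p)
  have hb : ∀ x, inner ℝ b x = p x := fun x => by
    simp [b]
  have hb0 : b ≠ 0 := by
    rintro h
    apply hp0
    ext1 x
    simp [← hb, h]
  have hbn : ‖b‖ ≠ 0 := norm_ne_zero_iff.2 hb0
  refine ⟨‖b‖⁻¹ • b, by rw [norm_smul, norm_inv, norm_norm, inv_mul_cancel₀ hbn], ?_⟩
  have hfix : ∀ x, inner ℝ (‖b‖⁻¹ • b) x = (0 : ℝ) → L x = x := by
    intro x hx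
    rw [real_inner_smul_left, hb] at hx
    have : x ∈ {x | p x = 0} := by simpa [hb0] using hx
    rw [← hp] at this
    exact this
  rcases eq_id_or_reflIn (by rw [norm_smul, norm_inv, norm_norm, inv_mul_cancel₀ hbn]) L hfix
    with h | h
  · exact absurd (by ext1 x; exact h x) hne
  · exact h

lemma isLin_reflIn {a : ModelSpace n} (ha : a ∈ cs.roots) : cs.IsLin (reflIn a) := by
  obtain ⟨h1, s, hs, w, hw, h⟩ := ha
  have : (reflIn a).toIsometryEquiv = w * s * w⁻¹ := by
    ext1 x; rw [h, ← reflIn_apply h1]; rfl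
  rw [IsLin, this]
  exact cs.Wbar.mul_mem (cs.Wbar.mul_mem hw (Subgroup.subset_closure hs)) (cs.Wbar.inv_mem hw)

lemma neg_mem_roots {a : ModelSpace n} (ha : a ∈ cs.roots) : -a ∈ cs.roots := by
  obtain ⟨h1, s, hs, w, hw, h⟩ := ha
  refine ⟨by rwa [norm_neg], s, hs, w, hw, fun x => ?_⟩
  rw [h]; simp

lemma reflIn_map (L : ModelSpace n ≃ₗᵢ[ℝ] ModelSpace n) {a : ModelSpace n} (ha : ‖a‖ = 1)
    (x : ModelSpace n) : L (reflIn a (L.symm x)) = reflIn (L a) x := by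
  rw [reflIn_apply ha, reflIn_apply (by rwa [L.norm_map]), map_sub, map_smul, L.apply_symm_apply,
    ← LinearIsometryEquiv.inner_map_map L a, L.apply_symm_apply]

lemma IsLin.map_roots {L : ModelSpace n ≃ₗᵢ[ℝ] ModelSpace n} (hL : cs.IsLin L) {a : ModelSpace n}
    (ha : a ∈ cs.roots) : L a ∈ cs.roots := by
  obtain ⟨h1, s, hs, w, hw, h⟩ := ha
  refine ⟨by rwa [L.norm_map], s, hs, L.toIsometryEquiv * w, cs.Wbar.mul_mem hL hw, fun x => ?_⟩
  rw [← reflIn_apply (by rwa [L.norm_map]), ← reflIn_map L h1, reflIn_apply h1, ← h]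
  simp only [mul_inv_rev, IsometryEquiv.mul_apply]
  rfl

lemma eq_or_eq_neg_of_reflIn {a b : ModelSpace n} (ha : ‖a‖ = 1) (hb : ‖b‖ = 1)
    (h : reflIn a b = - b) : b = a ∨ b = -a := by
  rw [reflIn_apply ha] at h
  have h2 : b = (inner ℝ a b : ℝ) • a := by
    have : (2 : ℝ) • b = (2 : ℝ) • ((inner ℝ a b : ℝ) • a) := by
      rw [smul_smul, two_smul]
      rw [sub_eq_iff_eq_add] at h
      nth_rewrite 1 [h]; abel
    exact smul_right_injective _ (two_ne_zero' ℝ) this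
  have h3 : |(inner ℝ a b : ℝ)| = 1 := by
    have := hb
    rw [h2, norm_smul, ha] at this
    simpa using this
  rcases eq_or_eq_neg_of_abs_eq h3 with h4 | h4
  · left; rw [h4] at h2; simpa using h2
  · right; rw [h4] at h2; simpa using h2

lemma reflIn_self {a : ModelSpace n} (ha : ‖a‖ = 1) : reflIn a a = -a := by
  rw [reflIn_apply ha, real_inner_self_eq_norm_sq, ha]
  simp [two_smul]

/-- Proportional unit vectors, detected by their orthogonal hyperplanes. -/
lemma eq_or_eq_neg_of_ker {a b : ModelSpace n} (ha : ‖a‖ = 1) (hb : ‖b‖ = 1)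
    (h : ∀ x, inner ℝ a x = (0 : ℝ) → inner ℝ b x = (0 : ℝ)) : b = a ∨ b = -a := by
  apply eq_or_eq_neg_of_reflIn ha hb
  have hfix : ∀ x, inner ℝ b x = (inner ℝ a x : ℝ) * inner ℝ b a := by
    intro x
    have h1 : inner ℝ a (x - (inner ℝ a x : ℝ) • a) = (0 : ℝ) := by
      rw [inner_sub_right, inner_smul_right, real_inner_self_eq_norm_sq, ha]; ring
    have h2 := h _ h1
    rw [inner_sub_right, inner_smul_right] at h2
    linarith
  rw [reflIn_apply ha]
  have h3 : b = (inner ℝ b a : ℝ) • a := by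
    apply ext_inner_right ℝ
    intro x
    rw [hfix, real_inner_smul_left]; ring
  have h4 : (2 * inner ℝ a b : ℝ) • a = b + b := by
    rw [mul_smul, two_smul, real_inner_comm, ← h3]
  rw [h4]; abel

lemma finite_roots : cs.roots.Finite := by
  have := cs.finiteW
  refine Set.Finite.of_finite_fibers (fun a => (reflIn a).toIsometryEquiv) ?_ ?_
  · refine Set.Finite.subset (s := (cs.Wbar : Set (ModelSpace n ≃ᵢ ModelSpace n))) this ?_
    rintro _ ⟨a, ha, rfl⟩
    exact isLin_reflIn ha
  · rintro _ ⟨a, ha, rfl⟩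
    refine Set.Finite.subset (Set.toFinite {a, -a}) ?_
    rintro b ⟨hb, hab⟩
    have h1 : reflIn b b = reflIn a b := congrArg (fun w : ModelSpace n ≃ᵢ ModelSpace n => w b) hab
    rw [reflIn_self hb.1] at h1
    exact eq_or_eq_neg_of_reflIn ha.1 hb.1 h1.symm

end SphericalCoxeterSystem

namespace SphericalCoxeterSystem

variable {n : ℕ} {cs : SphericalCoxeterSystem n}

lemma reflIn_eq_self_iff {a : ModelSpace n} (ha : ‖a‖ = 1) (x : ModelSpace n) :
    reflIn a x = x ↔ inner ℝ a x = (0 : ℝ) := by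
  refine ⟨fun h => ?_, reflIn_of_orthogonal ha⟩
  have := inner_reflIn ha x
  rw [h] at this
  linarith

lemma isAffineReflection_iff {r : ModelSpace n ≃ᵢ ModelSpace n} :
    cs.IsAffineReflection r ↔ ∃ a ∈ cs.roots, ∃ b, ∀ y, r y = reflIn a (y - b) + b := by
  constructor
  · rintro ⟨s, hs, w, hw, rfl⟩
    obtain ⟨L, hL, b, hb⟩ := exists_affine_of_mem_W hw
    obtain ⟨a, ha, has⟩ := exists_unit_normal (cs.refl s hs)
    have har : a ∈ cs.roots :=
      ⟨ha, s, hs, 1, cs.Wbar.one_mem, fun x => by rw [← reflIn_apply ha, ← has]; simp⟩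
    refine ⟨L a, hL.map_roots har, b, fun y => ?_⟩
    have hinv : w⁻¹ y = L.symm (y - b) := by
      refine (w.toEquiv.symm_apply_eq).2 ?_
      change y = w _
      rw [hb]; simp
    rw [IsometryEquiv.mul_apply, IsometryEquiv.mul_apply, hinv, hb, has, reflIn_map L ha]
  · rintro ⟨a, ha, b, h⟩
    obtain ⟨h1, s, hs, w, hw, hsw⟩ := ha
    have ht : IsometryEquiv.addRight b ∈ cs.W := Subgroup.subset_closure (Or.inr ⟨b, fun x => rfl⟩)
    refine ⟨s, hs, IsometryEquiv.addRight b * w, cs.W.mul_mem ht (Wbar_le_W hw), ?_⟩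
    ext1 y
    rw [h, reflIn_apply h1, ← hsw, mul_inv_rev]
    simp only [IsometryEquiv.mul_apply]
    have hinv : (IsometryEquiv.addRight b)⁻¹ y = y - b :=
      ((IsometryEquiv.addRight b).toEquiv.symm_apply_eq).2 (sub_add_cancel y b).symm
    rw [hinv]; rfl

lemma fixed_iff {a b : ModelSpace n} (ha : ‖a‖ = 1) (y : ModelSpace n) :
    reflIn a (y - b) + b = y ↔ inner ℝ a (y - b) = (0 : ℝ) := by
  rw [← reflIn_eq_self_iff ha, eq_sub_iff_add_eq]

lemma isModelWall_iff {M : Set (ModelSpace n)} :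
    cs.IsModelWall M ↔ ∃ a ∈ cs.roots, ∃ b, M = {y | inner ℝ a (y - b) = (0 : ℝ)} := by
  constructor
  · rintro ⟨r, hr, rfl⟩
    obtain ⟨a, ha, b, h⟩ := isAffineReflection_iff.1 hr
    exact ⟨a, ha, b, by simp only [h, fixed_iff ha.1]⟩
  · rintro ⟨a, ha, b, rfl⟩
    let r : ModelSpace n ≃ᵢ ModelSpace n := ((IsometryEquiv.addRight (-b)).trans
      (reflIn a).toIsometryEquiv).trans (IsometryEquiv.addRight b)
    have h : ∀ y, r y = reflIn a (y - b) + b := fun y => by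
      rw [sub_eq_add_neg]; rfl
    exact ⟨r, isAffineReflection_iff.2 ⟨a, ha, b, h⟩, by simp only [h, fixed_iff ha.1]⟩

lemma mem_half_of_lt {a b : ModelSpace n} {H : Set (ModelSpace n)} (hH : Convex ℝ H)
    (hM : ∀ y, inner ℝ a (y - b) = (0 : ℝ) → y ∈ H) {y q : ModelSpace n} (hy : y ∈ H) {l : ℝ}
    (hl0 : 0 ≤ l) (hl1 : l < 1) (h : inner ℝ a (q - b) = l * inner ℝ a (y - b)) : q ∈ H := by
  have h1 : (1 - l) ≠ 0 := by linarith
  have hm : b + (1 - l)⁻¹ • ((q - b) - l • (y - b)) ∈ H := by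
    apply hM
    rw [add_sub_cancel_left, inner_smul_right, inner_sub_right, inner_smul_right, h]; ring
  have := hH hy hm hl0 (by linarith : 0 ≤ 1 - l) (by ring)
  convert this using 1
  rw [smul_add, smul_smul, mul_inv_cancel₀ h1, one_smul, sub_smul, smul_sub, one_smul]
  abel

lemma isModelHalf_iff {M H : Set (ModelSpace n)} :
    cs.IsModelHalf M H ↔ ∃ a ∈ cs.roots, ∃ b, M = {y | inner ℝ a (y - b) = (0 : ℝ)} ∧
      H = {y | (0 : ℝ) ≤ inner ℝ a (y - b)} := by
  constructor
  · rintro ⟨r, hr, hM, -, hconv, hU, hI⟩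
    obtain ⟨a, ha, b, h⟩ := isAffineReflection_iff.1 hr
    have hM' : M = {y | inner ℝ a (y - b) = (0 : ℝ)} := by
      rw [hM]; simp only [h, fixed_iff ha.1]
    have hMH : ∀ y, inner ℝ a (y - b) = (0 : ℝ) → y ∈ H := fun y hy => by
      have : y ∈ M := by rw [hM']; exact hy
      rw [← hI] at this
      exact this.1
    have hr1 : ∀ y, inner ℝ a (r y - b) = - (inner ℝ a (y - b) : ℝ) := fun y => by
      rw [h, add_sub_cancel_right, inner_reflIn ha.1]
    have hr2 : ∀ y, r (r y) = y := fun y => by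
      rw [h, h, add_sub_cancel_right, reflIn_reflIn, sub_add_cancel]
    have key : (∀ y ∈ H, (0 : ℝ) ≤ inner ℝ a (y - b)) ∨ (∀ y ∈ H, inner ℝ a (y - b) ≤ (0 : ℝ)) := by
      by_contra! hcon
      obtain ⟨⟨z, hz, hz0⟩, y, hy, hy0⟩ := hcon
      set p : ℝ := inner ℝ a (y - b)
      set m : ℝ := inner ℝ a (z - b) with hm
      have ht : ∃ t, 0 < t ∧ t < p ∧ t < -m :=
        ⟨min p (-m) / 2, by have := lt_min hy0 (neg_pos.2 hz0); linarith,
          by have := lt_min hy0 (neg_pos.2 hz0); have := min_le_left p (-m); linarith,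
          by have := lt_min hy0 (neg_pos.2 hz0); have := min_le_right p (-m); linarith⟩
      obtain ⟨t, ht0, htp, htm⟩ := ht
      have hq : inner ℝ a (b + t • a - b) = t := by
        rw [add_sub_cancel_left, inner_smul_right, real_inner_self_eq_norm_sq, ha.1]; ring
      have h1 : b + t • a ∈ H := by
        refine mem_half_of_lt hconv hMH hy (l := t / p) (by positivity) ((div_lt_one hy0).2 htp) ?_
        rw [hq, div_mul_cancel₀ _ hy0.ne']
      have h2 : r (b + t • a) ∈ H := by
        refine mem_half_of_lt hconv hMH hz (l := t / (-m)) (div_nonneg ht0.le (by linarith))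
          ((div_lt_one (by linarith)).2 htm) ?_
        rw [hr1, hq, ← hm]
        have : m ≠ 0 := hz0.ne
        field_simp
      have h3 : b + t • a ∈ M := by
        rw [← hI]; exact ⟨h1, _, h2, hr2 _⟩
      rw [hM'] at h3
      exact ht0.ne' (hq.symm.trans h3)
    have hcov : ∀ y, y ∈ H ∨ r y ∈ H := fun y => by
      have : y ∈ H ∪ r '' H := by rw [hU]; trivial
      rcases this with h | ⟨z, hz, rfl⟩
      · exact Or.inl h
      · right; rwa [hr2]
    rcases key with hk | hk
    · refine ⟨a, ha, b, hM', Set.Subset.antisymm hk fun y (hy : (0 : ℝ) ≤ _) => ?_⟩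
      rcases hcov y with h | h
      · exact h
      · have := hk _ h
        rw [hr1] at this
        exact hMH y (by linarith)
    · refine ⟨-a, neg_mem_roots ha, b, by simp [hM'], ?_⟩
      refine Set.Subset.antisymm (fun y hy => ?_) fun y (hy : (0 : ℝ) ≤ _) => ?_
      · have := hk y hy
        simpa using this
      rw [inner_neg_left] at hy
      rcases hcov y with h | h
      · exact h
      · have := hk _ h
        rw [hr1] at this
        exact hMH y (by linarith)
  · rintro ⟨a, ha, b, rfl, rfl⟩
    let r : ModelSpace n ≃ᵢ ModelSpace n := ((IsometryEquiv.addRight (-b)).trans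
      (reflIn a).toIsometryEquiv).trans (IsometryEquiv.addRight b)
    have h : ∀ y, r y = reflIn a (y - b) + b := fun y => by
      rw [sub_eq_add_neg]; rfl
    have hr1 : ∀ y, inner ℝ a (r y - b) = - (inner ℝ a (y - b) : ℝ) := fun y => by
      rw [h, add_sub_cancel_right, inner_reflIn ha.1]
    have hr2 : ∀ y, r (r y) = y := fun y => by
      rw [h, h, add_sub_cancel_right, reflIn_reflIn, sub_add_cancel]
    have himg : r '' {y | (0 : ℝ) ≤ inner ℝ a (y - b)} = {y | inner ℝ a (y - b) ≤ (0 : ℝ)} := by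
      ext y
      constructor
      · rintro ⟨z, hz, rfl⟩
        change inner ℝ a (r z - b) ≤ (0 : ℝ)
        rw [hr1]
        have : (0 : ℝ) ≤ inner ℝ a (z - b) := hz
        linarith
      · intro hy
        refine ⟨r y, ?_, hr2 y⟩
        change (0 : ℝ) ≤ inner ℝ a (r y - b)
        rw [hr1]
        have : inner ℝ a (y - b) ≤ (0 : ℝ) := hy
        linarith
    refine ⟨r, isAffineReflection_iff.2 ⟨a, ha, b, h⟩, by simp only [h, fixed_iff ha.1], ?_, ?_,
      ?_, ?_⟩
    · exact isClosed_le continuous_const (by fun_prop)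
    · intro x hx y hy s t hs ht hst
      change (0 : ℝ) ≤ inner ℝ a _
      have h1 : (0 : ℝ) ≤ inner ℝ a (x - b) := hx
      have h2 : (0 : ℝ) ≤ inner ℝ a (y - b) := hy
      have : s • x + t • y - b = s • (x - b) + t • (y - b) := by
        have hb : b = s • b + t • b := by rw [← add_smul, hst, one_smul]
        nth_rewrite 1 [hb]
        rw [smul_sub, smul_sub]; abel
      rw [this, inner_add_right, inner_smul_right, inner_smul_right]
      positivity
    · rw [himg]
      ext y
      simpa using le_total (0 : ℝ) (inner ℝ a (y - b))
    · rw [himg]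
      ext y
      exact ⟨fun h => le_antisymm h.2 h.1, fun h => ⟨h.symm.le, h.le⟩⟩

end SphericalCoxeterSystem

namespace SphericalCoxeterSystem

variable {n : ℕ} (cs : SphericalCoxeterSystem n)

/-- A vector lying on no wall through the origin. -/
def Generic (v : ModelSpace n) : Prop := ∀ a ∈ cs.roots, inner ℝ a v ≠ (0 : ℝ)

/-- The closed Weyl chamber of a generic vector. -/
def cone (v : ModelSpace n) : Set (ModelSpace n) :=
  {y | ∀ a ∈ cs.roots, (0 : ℝ) ≤ inner ℝ a v * inner ℝ a y}

/-- Closed Weyl chambers of the model space, with apex at the origin. -/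
def IsChamber (K : Set (ModelSpace n)) : Prop := ∃ v, cs.Generic v ∧ K = cs.cone v

variable {cs}

lemma mul_nonneg_iff_nonpos_of_neg {a b : ℝ} (ha : a < 0) : 0 ≤ a * b ↔ b ≤ 0 := by
  rw [← neg_mul_neg, mul_nonneg_iff_of_pos_left (neg_pos.2 ha), neg_nonneg]

lemma isClosed_cone (v : ModelSpace n) : IsClosed (cs.cone v) := by
  have : cs.cone v = ⋂ a ∈ cs.roots, {y | (0 : ℝ) ≤ inner ℝ a v * inner ℝ a y} := by
    ext y; simp [cone]
  rw [this]
  exact isClosed_biInter fun a _ => isClosed_le continuous_const (by fun_prop)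

lemma eventually_pos (v y : ModelSpace n) (s : Set (ModelSpace n)) (hs : s.Finite)
    (h : ∀ a ∈ s, (0 : ℝ) < inner ℝ a v * inner ℝ a y) (z : ModelSpace n) :
    ∀ᶠ t : ℝ in 𝓝[>] 0, ∀ a ∈ s, (0 : ℝ) < inner ℝ a v * inner ℝ a (y + t • z) := by
  rw [Filter.eventually_all_finite hs]
  intro a ha
  have hc : ContinuousAt (fun t : ℝ => (inner ℝ a v * inner ℝ a (y + t • z) : ℝ)) 0 := by fun_prop
  have := hc.eventually (Ioi_mem_nhds (by simpa using h a ha))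
  exact this.filter_mono nhdsWithin_le_nhds

lemma dense_compl_hyperplane {a : ModelSpace n} (ha : a ≠ 0) :
    Dense {v : ModelSpace n | inner ℝ a v ≠ (0 : ℝ)} := by
  intro y
  by_cases h : inner ℝ a y = (0 : ℝ)
  · have hc : Tendsto (fun t : ℝ => y + t • a) (𝓝[>] 0) (𝓝 y) := by
      have : ContinuousAt (fun t : ℝ => y + t • a) 0 := by fun_prop
      simpa using this.tendsto.mono_left nhdsWithin_le_nhds
    refine mem_closure_of_tendsto hc ?_
    filter_upwards [self_mem_nhdsWithin] with t ht
    have ht : 0 < t := ht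
    change inner ℝ a (y + t • a) ≠ (0 : ℝ)
    rw [inner_add_right, h, inner_smul_right, zero_add]
    exact mul_ne_zero ht.ne' (inner_self_ne_zero.2 ha)
  · exact subset_closure h

lemma dense_generic : Dense {v | cs.Generic v} := by
  have : {v | cs.Generic v} = ⋂ a ∈ cs.roots, {v | inner ℝ a v ≠ (0 : ℝ)} := by
    ext y; simp [Generic]
  rw [this]
  refine dense_biInter_of_isOpen (fun a _ => ?_) finite_roots.countable fun a ha => ?_
  · exact isOpen_ne_fun (by fun_prop) continuous_const
  · exact dense_compl_hyperplane (by rintro rfl; simpa using ha.1)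

lemma exists_generic : ∃ v, cs.Generic v := dense_generic.nonempty

lemma exists_generic_cone_of_signs {F : Set (ModelSpace n)}
    (hF : ∀ a ∈ cs.roots, (∀ y ∈ F, (0 : ℝ) ≤ inner ℝ a y) ∨ ∀ y ∈ F, inner ℝ a y ≤ (0 : ℝ)) :
    ∃ v, cs.Generic v ∧ F ⊆ cs.cone v := by
  classical
  have hch : ∀ a, ∃ y, (F.Nonempty → y ∈ F) ∧ ((∃ z ∈ F, inner ℝ a z ≠ (0 : ℝ)) →
      inner ℝ a y ≠ (0 : ℝ)) := fun a => by
    by_cases h : ∃ z ∈ F, inner ℝ a z ≠ (0 : ℝ)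
    · obtain ⟨z, hz, h0⟩ := h
      exact ⟨z, fun _ => hz, fun _ => h0⟩
    · by_cases hne : F.Nonempty
      · exact ⟨hne.some, fun _ => hne.some_mem, fun h' => absurd h' h⟩
      · exact ⟨0, fun h' => absurd h' hne, fun h' => absurd h' h⟩
  choose Y hYF hY using hch
  obtain ⟨g, hg⟩ := exists_generic (cs := cs)
  rcases F.eq_empty_or_nonempty with rfl | hne
  · exact ⟨g, hg, Set.empty_subset _⟩
  set R := (finite_roots (cs := cs)).toFinset with hR
  have hmemR : ∀ {a}, a ∈ R ↔ a ∈ cs.roots := fun {a} => by simp [hR]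
  set y0 := ∑ b ∈ R, Y b
  have hin : ∀ a, (inner ℝ a y0 : ℝ) = ∑ b ∈ R, inner ℝ a (Y b) := fun a => inner_sum _ _ _
  -- the sum of the chosen points is off every wall not containing `F`
  have hprod : ∀ a ∈ cs.roots, ∀ z ∈ F, inner ℝ a z ≠ (0 : ℝ) →
      (0 : ℝ) < inner ℝ a y0 * inner ℝ a z := by
    intro a ha z hz hz0
    have hYa := hY a ⟨z, hz, hz0⟩
    rcases hF a ha with h | h
    · refine mul_pos ?_ ((h z hz).lt_of_ne' hz0)
      rw [hin]
      exact Finset.sum_pos' (fun b _ => h _ (hYF b hne))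
        ⟨a, hmemR.2 ha, (h _ (hYF a hne)).lt_of_ne' hYa⟩
    · refine mul_pos_of_neg_of_neg ?_ ((h z hz).lt_of_ne hz0)
      rw [hin, ← neg_pos, ← Finset.sum_neg_distrib]
      exact Finset.sum_pos' (fun b _ => neg_nonneg.2 (h _ (hYF b hne)))
        ⟨a, hmemR.2 ha, neg_pos.2 ((h _ (hYF a hne)).lt_of_ne hYa)⟩
  have hev := eventually_pos y0 y0 {a ∈ cs.roots | inner ℝ a y0 ≠ (0 : ℝ)}
    (finite_roots.subset (Set.sep_subset _ _)) (fun a ha => mul_self_pos.2 ha.2) g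
  obtain ⟨t, ht, ht0⟩ := (hev.and self_mem_nhdsWithin).exists
  have ht0 : 0 < t := ht0
  refine ⟨y0 + t • g, fun a ha h0 => ?_, fun z hz a ha => ?_⟩
  · by_cases h : inner ℝ a y0 = (0 : ℝ)
    · rw [inner_add_right, h, inner_smul_right, zero_add] at h0
      exact (mul_ne_zero ht0.ne' (hg a ha)) h0
    · have := ht a ⟨ha, h⟩
      rw [h0, mul_zero] at this
      exact this.false
  · by_cases h : inner ℝ a z = (0 : ℝ)
    · rw [h, mul_zero]
    · have h1 := hprod a ha z hz h
      have h2 := ht a ⟨ha, fun h0 => by rw [h0, zero_mul] at h1; exact h1.false⟩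
      have h3 : (0 : ℝ) < inner ℝ a y0 * inner ℝ a y0 * (inner ℝ a (y0 + t • g) * inner ℝ a z) := by
        have := mul_pos h1 h2
        linarith
      exact (pos_of_mul_pos_right h3 (mul_self_nonneg _)).le

/-- A wall through `x` is the wall of some root through `x`. -/
lemma isModelWall_iff_of_mem {M : Set (ModelSpace n)} {x : ModelSpace n} :
    cs.IsModelWall M ∧ x ∈ M ↔ ∃ a ∈ cs.roots, M = {y | inner ℝ a (y - x) = (0 : ℝ)} := by
  constructor
  · rintro ⟨h, hx⟩
    obtain ⟨a, ha, b, rfl⟩ := isModelWall_iff.1 h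
    refine ⟨a, ha, ?_⟩
    have hx : inner ℝ a (x - b) = (0 : ℝ) := hx
    ext y
    change inner ℝ a (y - b) = (0 : ℝ) ↔ inner ℝ a (y - x) = (0 : ℝ)
    rw [show y - b = (y - x) + (x - b) by abel, inner_add_right, hx, add_zero]
  · rintro ⟨a, ha, rfl⟩
    exact ⟨isModelWall_iff.2 ⟨a, ha, x, rfl⟩, by simp⟩

lemma exists_cone_of_isModelSectorFace {x : ModelSpace n} {F : Set (ModelSpace n)}
    (h : cs.IsModelSectorFace x F) : ∃ v, cs.Generic v ∧ F ⊆ (fun y => x + y) '' cs.cone v := by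
  obtain ⟨-, σ, hσ, rfl⟩ := h
  set F := ⋂ M ∈ {M | cs.IsModelWall M ∧ x ∈ M}, σ M
  suffices hsign : ∀ a ∈ cs.roots, (∀ y ∈ (fun y => y - x) '' F, (0 : ℝ) ≤ inner ℝ a y) ∨
      ∀ y ∈ (fun y => y - x) '' F, inner ℝ a y ≤ (0 : ℝ) by
    obtain ⟨v, hv, hFv⟩ := exists_generic_cone_of_signs hsign
    exact ⟨v, hv, fun y hy => ⟨y - x, hFv ⟨y, hy, rfl⟩, by simp⟩⟩
  intro a ha
  set M := {y | inner ℝ a (y - x) = (0 : ℝ)} with hM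
  have hMw := isModelWall_iff_of_mem.2 ⟨a, ha, hM⟩
  have hFM : F ⊆ σ M := Set.biInter_subset_of_mem hMw
  rcases hσ M hMw.1 hMw.2 with h | h
  · left
    rintro _ ⟨y, hy, rfl⟩
    have := hFM hy
    rw [h] at this
    exact (show inner ℝ a (y - x) = (0 : ℝ) from this).symm.le
  · obtain ⟨a', ha', b, hMb, hH⟩ := isModelHalf_iff.1 h
    have hxb : inner ℝ a' (x - b) = (0 : ℝ) := by
      have := hMw.2
      rw [hMb] at this
      exact this
    have hsplit : ∀ y, (inner ℝ a' (y - b) : ℝ) = inner ℝ a' (y - x) := fun y => by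
      rw [show y - b = (y - x) + (x - b) by abel, inner_add_right, hxb, add_zero]
    have hker : ∀ z, inner ℝ a z = (0 : ℝ) → inner ℝ a' z = (0 : ℝ) := fun z hz => by
      have : z + x ∈ M := by
        change inner ℝ a (z + x - x) = (0 : ℝ)
        rwa [add_sub_cancel_right]
      rw [hMb] at this
      have := this.symm.trans (hsplit _)
      rw [add_sub_cancel_right] at this
      exact this.symm
    have hy' : ∀ y ∈ F, (0 : ℝ) ≤ inner ℝ a' (y - x) := fun y hy => by
      have := hFM hy
      rw [hH] at this
      rw [← hsplit]
      exact this
    rcases eq_or_eq_neg_of_ker ha.1 ha'.1 hker with rfl | rfl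
    · left
      rintro _ ⟨y, hy, rfl⟩
      exact hy' y hy
    · right
      rintro _ ⟨y, hy, rfl⟩
      have := hy' y hy
      rw [inner_neg_left] at this
      linarith

lemma isModelSectorFace_cone (x : ModelSpace n) {v : ModelSpace n} (hv : cs.Generic v) :
    cs.IsModelSectorFace x ((fun y => x + y) '' cs.cone v) := by
  classical
  refine ⟨⟨x + 0, 0, fun a _ => by simp, rfl⟩, ?_⟩
  have hch : ∀ M, ∃ N : Set (ModelSpace n), ∀ a ∈ cs.roots,
      M = {y | inner ℝ a (y - x) = (0 : ℝ)} →
        N = {y | (0 : ℝ) ≤ inner ℝ a v * inner ℝ a (y - x)} := by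
    intro M
    by_cases h : ∃ a ∈ cs.roots, M = {y | inner ℝ a (y - x) = (0 : ℝ)}
    · obtain ⟨a, ha, hM⟩ := h
      refine ⟨{y | (0 : ℝ) ≤ inner ℝ a v * inner ℝ a (y - x)}, fun a' ha' hM' => ?_⟩
      have hker : ∀ z, inner ℝ a z = (0 : ℝ) → inner ℝ a' z = (0 : ℝ) := fun z hz => by
        have : z + x ∈ M := by
          rw [hM]
          change inner ℝ a (z + x - x) = (0 : ℝ)
          rwa [add_sub_cancel_right]
        rw [hM'] at this
        change inner ℝ a' (z + x - x) = (0 : ℝ) at this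
        rwa [add_sub_cancel_right] at this
      rcases eq_or_eq_neg_of_ker ha.1 ha'.1 hker with rfl | rfl
      · rfl
      · simp
    · exact ⟨∅, fun a ha hM => absurd ⟨a, ha, hM⟩ h⟩
  choose σ hσ using hch
  refine ⟨σ, fun M hM hx => Or.inr ?_, ?_⟩
  · obtain ⟨a, ha, hMa⟩ := isModelWall_iff_of_mem.1 ⟨hM, hx⟩
    rw [hσ M a ha hMa, isModelHalf_iff]
    rcases (hv a ha).lt_or_gt with h | h
    · refine ⟨-a, neg_mem_roots ha, x, by simp [hMa], ?_⟩
      ext y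
      simp [mul_nonneg_iff_nonpos_of_neg h]
    · refine ⟨a, ha, x, hMa, ?_⟩
      ext y
      simp [h]
  · ext y
    simp only [Set.mem_iInter, Set.mem_image]
    constructor
    · rintro ⟨z, hz, rfl⟩ M hM
      obtain ⟨a, ha, hMa⟩ := isModelWall_iff_of_mem.1 hM
      rw [hσ M a ha hMa]
      simpa using hz a ha
    · intro h
      refine ⟨y - x, fun a ha => ?_, by simp⟩
      have := h _ (isModelWall_iff_of_mem.2 ⟨a, ha, rfl⟩)
      rw [hσ _ a ha rfl] at this
      exact this

lemma cone_eq_of_mem {v v' : ModelSpace n} (hv : cs.Generic v) (hv' : cs.Generic v')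
    (h : v ∈ cs.cone v') : cs.cone v = cs.cone v' := by
  ext y
  refine forall₂_congr fun a ha => ?_
  have h1 : (0 : ℝ) < inner ℝ a v' * inner ℝ a v :=
    (h a ha).lt_of_ne' (mul_ne_zero (hv' a ha) (hv a ha))
  rcases (hv' a ha).lt_or_gt with h2 | h2
  · have h3 := (neg_iff_neg_of_mul_pos h1).1 h2
    rw [mul_nonneg_iff_nonpos_of_neg h2, mul_nonneg_iff_nonpos_of_neg h3]
  · have h3 := (pos_iff_pos_of_mul_pos h1).1 h2
    rw [mul_nonneg_iff_of_pos_left h2, mul_nonneg_iff_of_pos_left h3]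

lemma self_mem_cone (v : ModelSpace n) : v ∈ cs.cone v := fun _ _ => mul_self_nonneg _

lemma isModelSector_iff {x : ModelSpace n} {s : Set (ModelSpace n)} :
    cs.IsModelSector x s ↔ ∃ K, cs.IsChamber K ∧ s = (fun y => x + y) '' K := by
  constructor
  · rintro ⟨hs, hmax⟩
    obtain ⟨v, hv, hsv⟩ := exists_cone_of_isModelSectorFace hs
    exact ⟨cs.cone v, ⟨v, hv, rfl⟩, (hmax _ (isModelSectorFace_cone x hv) hsv).symm⟩
  · rintro ⟨_, ⟨v, hv, rfl⟩, rfl⟩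
    refine ⟨isModelSectorFace_cone x hv, fun F' hF' hsub => ?_⟩
    obtain ⟨v', hv', hsv'⟩ := exists_cone_of_isModelSectorFace hF'
    have hmem : v ∈ cs.cone v' := by
      obtain ⟨z, hz, hzv⟩ := hsv' (hsub ⟨v, self_mem_cone v, rfl⟩)
      rwa [← add_left_cancel hzv]
    rw [cone_eq_of_mem hv hv' hmem] at hsub ⊢
    exact Set.Subset.antisymm hsv' hsub

namespace IsChamber

variable {K : Set (ModelSpace n)}

lemma isClosed (hK : cs.IsChamber K) : IsClosed K := by
  obtain ⟨v, hv, rfl⟩ := hK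
  exact isClosed_cone v

lemma zero_mem (hK : cs.IsChamber K) : (0 : ModelSpace n) ∈ K := by
  obtain ⟨v, hv, rfl⟩ := hK
  intro a _; simp

lemma add_mem (hK : cs.IsChamber K) {x y : ModelSpace n} (hx : x ∈ K) (hy : y ∈ K) :
    x + y ∈ K := by
  obtain ⟨v, hv, rfl⟩ := hK
  intro a ha
  rw [inner_add_right, mul_add]
  exact add_nonneg (hx a ha) (hy a ha)

lemma smul_mem (hK : cs.IsChamber K) {x : ModelSpace n} (hx : x ∈ K) {t : ℝ} (ht : 0 ≤ t) :
    t • x ∈ K := by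
  obtain ⟨v, hv, rfl⟩ := hK
  intro a ha
  rw [inner_smul_right, mul_left_comm]
  exact mul_nonneg ht (hx a ha)

lemma neg (hK : cs.IsChamber K) : cs.IsChamber ((fun x => -x) '' K) := by
  obtain ⟨v, hv, rfl⟩ := hK
  refine ⟨-v, fun a ha => by simpa using hv a ha, ?_⟩
  ext y
  constructor
  · rintro ⟨z, hz, rfl⟩ a ha
    simpa using hz a ha
  · intro hy
    exact ⟨-y, fun a ha => by simpa using hy a ha, by simp⟩

lemma map (hK : cs.IsChamber K) {L : ModelSpace n ≃ₗᵢ[ℝ] ModelSpace n} (hL : cs.IsLin L) :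
    cs.IsChamber (L '' K) := by
  obtain ⟨v, hv, rfl⟩ := hK
  have key : ∀ a y, (inner ℝ a (L y) : ℝ) = inner ℝ (L.symm a) y := fun a y => by
    rw [← LinearIsometryEquiv.inner_map_map L (L.symm a), L.apply_symm_apply]
  refine ⟨L v, fun a ha => by rw [key]; exact hv _ (hL.symm.map_roots ha), ?_⟩
  ext y
  constructor
  · rintro ⟨z, hz, rfl⟩ a ha
    rw [key, key]
    exact hz _ (hL.symm.map_roots ha)
  · intro hy
    refine ⟨L.symm y, fun a ha => ?_, by simp⟩
    have := hy _ (hL.map_roots ha)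
    rwa [LinearIsometryEquiv.inner_map_map, ← L.apply_symm_apply y,
      LinearIsometryEquiv.inner_map_map] at this

lemma eq_of_subset (hK : cs.IsChamber K) {K' : Set (ModelSpace n)} (hK' : cs.IsChamber K')
    (h : K ⊆ K') : K = K' := by
  obtain ⟨v, hv, rfl⟩ := hK
  obtain ⟨v', hv', rfl⟩ := hK'
  exact cone_eq_of_mem hv hv' (h (self_mem_cone v))

/-- Every vector can be pushed into a chamber. -/
lemma exists_smul_add_mem (hK : cs.IsChamber K) : ∃ v ∈ K, cs.Generic v ∧
    ∀ x, ∃ t : ℝ, 0 < t ∧ v + t • x ∈ K := by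
  obtain ⟨v, hv, rfl⟩ := hK
  refine ⟨v, self_mem_cone v, hv, fun x => ?_⟩
  obtain ⟨t, ht, ht0⟩ := ((eventually_pos v v cs.roots finite_roots
    (fun a ha => mul_self_pos.2 (hv a ha)) x).and self_mem_nhdsWithin).exists
  exact ⟨t, ht0, fun a ha => (ht a ha).le⟩

lemma exists_sub (hK : cs.IsChamber K) (x : ModelSpace n) : ∃ y ∈ K, ∃ z ∈ K, x = y - z := by
  obtain ⟨v, hv, -, h⟩ := hK.exists_smul_add_mem
  obtain ⟨t, ht, hx⟩ := h x
  refine ⟨t⁻¹ • (v + t • x), hK.smul_mem hx (by positivity), t⁻¹ • v,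
    hK.smul_mem hv (by positivity), ?_⟩
  rw [smul_add, smul_smul, inv_mul_cancel₀ ht.ne']
  simp

lemma eq_of_dist_eq (hK : cs.IsChamber K) {x y : ModelSpace n}
    (h : ∀ k ∈ K, dist k x = dist k y) : x = y := by
  have h0 := h 0 hK.zero_mem
  rw [dist_zero_left, dist_zero_left] at h0
  have h1 : ∀ k ∈ K, inner ℝ k (x - y) = (0 : ℝ) := fun k hk => by
    have h2 := h k hk
    rw [dist_eq_norm, dist_eq_norm] at h2
    have h3 := norm_sub_sq_real k x
    have h4 := norm_sub_sq_real k y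
    rw [h2, h0] at h3
    rw [inner_sub_right]
    linarith
  obtain ⟨u, hu, w, hw, huw⟩ := hK.exists_sub (x - y)
  have : inner ℝ (x - y) (x - y) = (0 : ℝ) := by
    nth_rewrite 1 [huw]
    rw [inner_sub_left, h1 u hu, h1 w hw, sub_zero]
  exact sub_eq_zero.1 (inner_self_eq_zero.1 this)

lemma linear_ext (hK : cs.IsChamber K) {L M : ModelSpace n ≃ₗᵢ[ℝ] ModelSpace n}
    (h : ∀ k ∈ K, L k = M k) (x : ModelSpace n) : L x = M x := by
  obtain ⟨u, hu, w, hw, rfl⟩ := hK.exists_sub x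
  rw [map_sub, map_sub, h u hu, h w hw]

lemma exists_closedBall (hK : cs.IsChamber K) : ∃ e, Metric.closedBall e 1 ⊆ K := by
  obtain ⟨v, hv, rfl⟩ := hK
  have hopen : IsOpen {y | ∀ a ∈ cs.roots, (0 : ℝ) < inner ℝ a v * inner ℝ a y} := by
    simp only [Set.ofPred_forall]
    exact finite_roots.isOpen_biInter fun a _ => isOpen_lt continuous_const (by fun_prop)
  obtain ⟨ε, hε, hball⟩ := Metric.nhds_basis_closedBall.mem_iff.1
    (hopen.mem_nhds (show v ∈ _ from fun a ha => mul_self_pos.2 (hv a ha)))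
  refine ⟨ε⁻¹ • v, fun y hy => ?_⟩
  have h1 : ε • y ∈ Metric.closedBall v ε := by
    have : ε • y - v = ε • (y - ε⁻¹ • v) := by
      rw [smul_sub, smul_smul, mul_inv_cancel₀ hε.ne', one_smul]
    rw [Metric.mem_closedBall, dist_eq_norm] at hy ⊢
    rw [this, norm_smul, Real.norm_of_nonneg hε.le]
    nlinarith
  have h2 : ε • y ∈ cs.cone v := fun a ha => (hball h1 a ha).le
  have h3 := smul_mem (cs := cs) ⟨v, hv, rfl⟩ h2 (inv_nonneg.2 hε.le)
  rwa [smul_smul, inv_mul_cancel₀ hε.ne', one_smul] at h3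

end IsChamber

lemma exists_mem_chamber (y : ModelSpace n) : ∃ K, cs.IsChamber K ∧ y ∈ K := by
  obtain ⟨v, hv, h⟩ := exists_generic_cone_of_signs (cs := cs) (F := {y}) (fun a _ => by
    rcases le_total (0 : ℝ) (inner ℝ a y) with h | h
    · exact Or.inl fun z hz => by rw [Set.mem_singleton_iff.1 hz]; exact h
    · exact Or.inr fun z hz => by rw [Set.mem_singleton_iff.1 hz]; exact h)
  exact ⟨_, ⟨v, hv, rfl⟩, h rfl⟩

lemma finite_chambers : {K | cs.IsChamber K}.Finite := by
  have hfin : {R | R ⊆ cs.roots}.Finite := finite_roots.finite_subsets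
  refine (hfin.image fun R => {y | ∀ a ∈ cs.roots,
    (a ∈ R → (0 : ℝ) ≤ inner ℝ a y) ∧ (a ∉ R → inner ℝ a y ≤ (0 : ℝ))}).subset ?_
  rintro _ ⟨v, hv, rfl⟩
  refine ⟨{a ∈ cs.roots | (0 : ℝ) < inner ℝ a v}, Set.sep_subset _ _, ?_⟩
  ext y
  refine forall₂_congr fun a ha => ?_
  rcases (hv a ha).lt_or_gt with h | h
  · simp [mul_nonneg_iff_nonpos_of_neg h, h.not_gt]
  · simp [h, ha]

end SphericalCoxeterSystem

/-- Chaining along a segment covered by finitely many closed sets. -/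
lemma interval_chain {ι : Type*} [DecidableEq ι] {R : ℝ → ℝ → Prop} (I : ι → Set ℝ)
    (hI : ∀ i, IsClosed (I i)) (hR : ∀ x y z, x ≤ y → y ≤ z → R x y → R y z → R x z) {b : ℝ}
    (s : Finset ι) : ∀ a, a ≤ b → Icc a b ⊆ ⋃ i ∈ s, I i →
      (∀ i ∈ s, ∀ x ∈ I i, ∀ y ∈ I i, a ≤ x → x ≤ y → y ≤ b → R x y) → R a b := by
  induction s using Finset.strongInduction with
  | H s ih =>
    intro a hab hcov h
    obtain ⟨i, hi, hai⟩ := mem_iUnion₂.1 (hcov (left_mem_Icc.2 hab))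
    have hC : IsCompact (I i ∩ Icc a b) := isCompact_Icc.inter_left (hI i)
    obtain ⟨c, ⟨hcI, hac, hcb⟩, hmax⟩ := hC.exists_isGreatest ⟨a, hai, left_mem_Icc.2 hab⟩
    have hRac := h i hi a hai c hcI le_rfl hac hcb
    rcases hcb.eq_or_lt with rfl | hlt
    · exact hRac
    refine hR a c b hac hcb hRac (ih (s.erase i) (Finset.erase_ssubset hi) c hcb ?_ ?_)
    · rw [← closure_Ioc hlt.ne]
      refine closure_minimal (fun x hx => ?_)
        ((s.erase i).finite_toSet.isClosed_biUnion fun j _ => hI j)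
      obtain ⟨j, hj, hxj⟩ := mem_iUnion₂.1 (hcov ⟨hac.trans hx.1.le, hx.2⟩)
      refine mem_iUnion₂.2 ⟨j, Finset.mem_erase.2 ⟨?_, hj⟩, hxj⟩
      rintro rfl
      exact (hmax ⟨hxj, hac.trans hx.1.le, hx.2⟩).not_gt hx.1
    · exact fun j hj x hx y hy hcx => h j (Finset.mem_of_mem_erase hj) x hx y hy (hac.trans hcx)

namespace SphericalCoxeterSystem

variable {n : ℕ} (cs : SphericalCoxeterSystem n)

/-- The chamber `K'` is adjacent to `K` across the wall of the root `a`, with `K` on the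
positive side. -/
structure Adj (a : ModelSpace n) (K K' : Set (ModelSpace n)) : Prop where
  mem : a ∈ cs.roots
  chamber : cs.IsChamber K
  nonneg : ∀ k ∈ K, (0 : ℝ) ≤ inner ℝ a k
  pos : ∃ k ∈ K, (0 : ℝ) < inner ℝ a k
  eq : K' = reflIn a '' K
  panel : ∀ y, inner ℝ a y = (0 : ℝ) → ∃ q₁ ∈ K ∩ K', ∃ q₂ ∈ K ∩ K', y = q₁ - q₂

variable {cs}

namespace Adj

variable {a : ModelSpace n} {K K' : Set (ModelSpace n)}

lemma chamber' (h : cs.Adj a K K') : cs.IsChamber K' := by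
  rw [h.eq]; exact h.chamber.map (isLin_reflIn h.mem)

lemma mem_iff (h : cs.Adj a K K') {y : ModelSpace n} : y ∈ K' ↔ reflIn a y ∈ K := by
  rw [h.eq]
  exact ⟨by rintro ⟨z, hz, rfl⟩; rwa [reflIn_reflIn], fun hy => ⟨_, hy, reflIn_reflIn _ _⟩⟩

lemma reflIn_mem (h : cs.Adj a K K') {y : ModelSpace n} (hy : y ∈ K) : reflIn a y ∈ K' := by
  rw [h.eq]; exact ⟨y, hy, rfl⟩

lemma symm (h : cs.Adj a K K') : cs.Adj (-a) K' K where
  mem := neg_mem_roots h.mem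
  chamber := h.chamber'
  nonneg k hk := by
    have := h.nonneg _ (h.mem_iff.1 hk)
    rwa [inner_reflIn h.mem.1, ← inner_neg_left] at this
  pos := by
    obtain ⟨k, hk, hp⟩ := h.pos
    refine ⟨_, h.reflIn_mem hk, ?_⟩
    rwa [inner_neg_left, inner_reflIn h.mem.1, neg_neg]
  eq := by
    ext y
    constructor
    · exact fun hy => ⟨_, h.reflIn_mem hy, by rw [reflIn_neg, reflIn_reflIn]⟩
    · rintro ⟨z, hz, rfl⟩
      rw [reflIn_neg]
      exact h.mem_iff.1 hz
  panel y hy := by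
    rw [inter_comm]
    exact h.panel y (by rwa [inner_neg_left, neg_eq_zero] at hy)

lemma neg (h : cs.Adj a K K') :
    cs.Adj (-a) ((fun x => -x) '' K) ((fun x => -x) '' K') where
  mem := neg_mem_roots h.mem
  chamber := h.chamber.neg
  nonneg k hk := by
    obtain ⟨z, hz, rfl⟩ := hk
    simpa using h.nonneg z hz
  pos := by
    obtain ⟨k, hk, hp⟩ := h.pos
    exact ⟨-k, ⟨k, hk, rfl⟩, by simpa using hp⟩
  eq := by
    rw [h.eq, image_image, image_image]
    simp [reflIn_neg]
  panel y hy := by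
    obtain ⟨q₁, h₁, q₂, h₂, rfl⟩ := h.panel y (by rwa [inner_neg_left, neg_eq_zero] at hy)
    exact ⟨-q₂, ⟨⟨q₂, h₂.1, rfl⟩, ⟨q₂, h₂.2, rfl⟩⟩, -q₁, ⟨⟨q₁, h₁.1, rfl⟩, ⟨q₁, h₁.2, rfl⟩⟩,
      by abel⟩

lemma nonpos (h : cs.Adj a K K') {y : ModelSpace n} (hy : y ∈ K') : inner ℝ a y ≤ (0 : ℝ) := by
  have := h.symm.nonneg y hy
  rwa [inner_neg_left, neg_nonneg] at this

lemma inner_eq_zero (h : cs.Adj a K K') {y : ModelSpace n} (hy : y ∈ K ∩ K') :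
    inner ℝ a y = (0 : ℝ) :=
  le_antisymm (h.nonpos hy.2) (h.nonneg y hy.1)

/-- A linear isometry that fixes the common panel is trivial or the reflection. -/
lemma eq_id_or_reflIn (h : cs.Adj a K K') (L : ModelSpace n ≃ₗᵢ[ℝ] ModelSpace n)
    (hL : ∀ q ∈ K ∩ K', L q = q) : (∀ x, L x = x) ∨ ∀ x, L x = reflIn a x := by
  refine SphericalCoxeterSystem.eq_id_or_reflIn h.mem.1 L fun x hx => ?_
  obtain ⟨q₁, h₁, q₂, h₂, rfl⟩ := h.panel x hx
  rw [map_sub, hL _ h₁, hL _ h₂]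

end Adj

lemma IsChamber.eq_cone {K : Set (ModelSpace n)} (hK : cs.IsChamber K) {v : ModelSpace n}
    (hv : cs.Generic v) (h : v ∈ K) : K = cs.cone v := by
  obtain ⟨v', hv', rfl⟩ := hK
  exact (cone_eq_of_mem hv hv' h).symm

lemma nonneg_of_mul_nonneg {p q t : ℝ} (ht : t ≠ 0) (hp : 0 ≤ p * t) (hq : 0 ≤ q * t) :
    0 ≤ p * q := by
  have h : 0 ≤ t * t * (p * q) := by nlinarith [mul_nonneg hp hq]
  exact nonneg_of_mul_nonneg_right h (mul_self_pos.2 ht)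

lemma exists_adj_of_pos_of_neg {v w y a : ModelSpace n} (hv : cs.Generic v) (hw : cs.Generic w)
    (hyv : y ∈ cs.cone v) (hyw : y ∈ cs.cone w)
    (hy : ∀ b ∈ cs.roots, inner ℝ b y = (0 : ℝ) → b = a ∨ b = -a) (ha : a ∈ cs.roots)
    (hav : (0 : ℝ) < inner ℝ a v) (haw : inner ℝ a w < (0 : ℝ)) :
    cs.Adj a (cs.cone v) (cs.cone w) := by
  have hay : inner ℝ a y = (0 : ℝ) :=
    le_antisymm ((mul_nonneg_iff_nonpos_of_neg haw).1 (hyw a ha))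
      ((mul_nonneg_iff_of_pos_left hav).1 (hyv a ha))
  have hry : reflIn a y = y := reflIn_of_orthogonal ha.1 hay
  have hmem : reflIn a v ∈ cs.cone w := by
    intro b hb
    by_cases hby : inner ℝ b y = (0 : ℝ)
    · have h0 : (0 : ℝ) ≤ inner ℝ a w * inner ℝ a (reflIn a v) := by
        rw [inner_reflIn ha.1]; nlinarith
      rcases hy b hb hby with rfl | rfl
      · exact h0
      · simpa using h0
    · rw [← inner_reflIn_left]
      have h1 := hyv (reflIn a b) ((isLin_reflIn ha).map_roots hb)
      rw [inner_reflIn_left a b y, hry] at h1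
      exact nonneg_of_mul_nonneg hby (hyw b hb) h1
  have hgen : cs.Generic (reflIn a v) := fun b hb => by
    rw [← inner_reflIn_left]
    exact hv _ ((isLin_reflIn ha).map_roots hb)
  refine ⟨ha, ⟨v, hv, rfl⟩, fun k hk => (mul_nonneg_iff_of_pos_left hav).1 (hk a ha),
    ⟨v, self_mem_cone v, hav⟩, ?_, fun z hz => ?_⟩
  · rw [← cone_eq_of_mem hgen hw hmem]
    exact ((IsChamber.map ⟨v, hv, rfl⟩ (isLin_reflIn ha)).eq_cone hgen
      ⟨v, self_mem_cone v, rfl⟩).symm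
  · obtain ⟨t, ht, ht0⟩ := ((eventually_pos y y {b ∈ cs.roots | inner ℝ b y ≠ (0 : ℝ)}
      (finite_roots.subset (Set.sep_subset _ _)) (fun a ha => mul_self_pos.2 ha.2) z).and
      self_mem_nhdsWithin).exists
    have ht0 : 0 < t := ht0
    have key : ∀ u, y ∈ cs.cone u → y + t • z ∈ cs.cone u := by
      intro u hu b hb
      by_cases hby : inner ℝ b y = (0 : ℝ)
      · have h0 : inner ℝ a (y + t • z) = (0 : ℝ) := by
          rw [inner_add_right, inner_smul_right, hay, hz]; simp
        rcases hy b hb hby with rfl | rfl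
        · rw [h0, mul_zero]
        · rw [inner_neg_left, inner_neg_left, h0]; simp
      · refine nonneg_of_mul_nonneg hby (hu b hb) ?_
        rw [mul_comm]
        exact (ht b ⟨hb, hby⟩).le
    have hc := key v hyv
    have hd := key w hyw
    refine ⟨t⁻¹ • (y + t • z), ⟨?_, ?_⟩, t⁻¹ • y, ⟨?_, ?_⟩, ?_⟩
    · exact IsChamber.smul_mem ⟨v, hv, rfl⟩ hc (inv_nonneg.2 ht0.le)
    · exact IsChamber.smul_mem ⟨w, hw, rfl⟩ hd (inv_nonneg.2 ht0.le)
    · exact IsChamber.smul_mem ⟨v, hv, rfl⟩ hyv (inv_nonneg.2 ht0.le)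
    · exact IsChamber.smul_mem ⟨w, hw, rfl⟩ hyw (inv_nonneg.2 ht0.le)
    · rw [smul_add, smul_smul, inv_mul_cancel₀ ht0.ne']
      simp

lemma eq_or_exists_adj {K K' : Set (ModelSpace n)} (hK : cs.IsChamber K) (hK' : cs.IsChamber K')
    {y : ModelSpace n} (hyK : y ∈ K) (hyK' : y ∈ K')
    (hy : ∀ a ∈ cs.roots, ∀ b ∈ cs.roots, inner ℝ a y = (0 : ℝ) → inner ℝ b y = (0 : ℝ) →
      b = a ∨ b = -a) : K = K' ∨ ∃ a, cs.Adj a K K' := by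
  obtain ⟨v, hv, rfl⟩ := hK
  obtain ⟨w, hw, rfl⟩ := hK'
  by_cases h : v ∈ cs.cone w
  · exact Or.inl (cone_eq_of_mem hv hw h)
  right
  have h : ∃ a ∈ cs.roots, inner ℝ a w * inner ℝ a v < (0 : ℝ) := by
    simpa [cone] using h
  obtain ⟨a, ha, hneg⟩ := h
  have key : ∀ a ∈ cs.roots, (0 : ℝ) < inner ℝ a v → inner ℝ a w < (0 : ℝ) →
      ∃ a, cs.Adj a (cs.cone v) (cs.cone w) := by
    intro a ha h1 h2
    have hay : inner ℝ a y = (0 : ℝ) :=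
      le_antisymm ((mul_nonneg_iff_nonpos_of_neg h2).1 (hyK' a ha))
        ((mul_nonneg_iff_of_pos_left h1).1 (hyK a ha))
    exact ⟨a, exists_adj_of_pos_of_neg hv hw hyK hyK' (fun b hb => hy a ha b hb hay) ha h1 h2⟩
  rcases mul_neg_iff.1 hneg with ⟨h1, h2⟩ | ⟨h1, h2⟩
  · exact key (-a) (neg_mem_roots ha) (by simpa using h2) (by simpa using h1)
  · exact key a ha h2 h1

/-- A generic vector of a chamber seen from `v` along a segment crossing one wall at a time. -/
lemma exists_generic_target {v : ModelSpace n} (hv : cs.Generic v) {K : Set (ModelSpace n)}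
    (hK : cs.IsChamber K) : ∃ w ∈ K, ∀ a ∈ cs.roots, ∀ b ∈ cs.roots, ¬ (b = a ∨ b = -a) →
      (inner ℝ a v * inner ℝ b w - inner ℝ b v * inner ℝ a w : ℝ) ≠ 0 := by
  obtain ⟨e, he⟩ := hK.exists_closedBall
  have hd : Dense (⋂ p ∈ {p : ModelSpace n × ModelSpace n | p ∈ cs.roots ×ˢ cs.roots ∧
      ¬ (p.2 = p.1 ∨ p.2 = -p.1)}, {w : ModelSpace n | inner ℝ
        ((inner ℝ p.1 v : ℝ) • p.2 - (inner ℝ p.2 v : ℝ) • p.1) w ≠ (0 : ℝ)}) := by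
    refine dense_biInter_of_isOpen (fun a _ => ?_) ?_ fun p hp => ?_
    · exact isOpen_ne_fun (by fun_prop) continuous_const
    · exact ((finite_roots.prod finite_roots).subset fun p hp => hp.1).countable
    · refine dense_compl_hyperplane fun h0 => hp.2 ?_
      refine eq_or_eq_neg_of_ker hp.1.1.1 hp.1.2.1 fun x hx => ?_
      have := congrArg (fun z => (inner ℝ z x : ℝ)) h0
      simp only [inner_sub_left, real_inner_smul_left, hx, inner_zero_left, mul_zero,
        sub_zero] at this
      exact (mul_eq_zero.1 this).resolve_left (hv _ hp.1.1)
  obtain ⟨w, hw, hwe⟩ := hd.inter_open_nonempty _ Metric.isOpen_ball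
    ⟨e, Metric.mem_ball_self (one_pos : (0 : ℝ) < 1)⟩
  refine ⟨w, he (Metric.ball_subset_closedBall hw), fun a ha b hb hab => ?_⟩
  have := mem_iInter₂.1 hwe (a, b) ⟨⟨ha, hb⟩, hab⟩
  simpa only [mem_ofPred_eq, inner_sub_left, real_inner_smul_left] using this

/-- Any two chambers are joined by a gallery. -/
lemma reflTransGen_adj {K K' : Set (ModelSpace n)} (hK : cs.IsChamber K) (hK' : cs.IsChamber K') :
    Relation.ReflTransGen (fun K K' => ∃ a, cs.Adj a K K') K K' := by
  classical
  obtain ⟨v, hv, rfl⟩ := hK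
  obtain ⟨w, hw, hvw⟩ := exists_generic_target hv hK'
  set c : ℝ → ModelSpace n := fun s => v + s • (w - v) with hc
  have hcont : Continuous c := by fun_prop
  have hgen : ∀ s, ∀ a ∈ cs.roots, ∀ b ∈ cs.roots, inner ℝ a (c s) = (0 : ℝ) →
      inner ℝ b (c s) = (0 : ℝ) → b = a ∨ b = -a := by
    intro s a ha b hb h1 h2
    by_contra hab
    simp only [hc, inner_add_right, inner_smul_right, inner_sub_right] at h1 h2
    have h3 : s * (inner ℝ a v * inner ℝ b w - inner ℝ b v * inner ℝ a w : ℝ) = 0 := by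
      linear_combination inner ℝ a v * h2 - inner ℝ b v * h1
    rcases mul_eq_zero.1 h3 with rfl | h3
    · exact hv a ha (by simpa using h1)
    · exact hvw a ha b hb hab h3
  have hloc : ∀ s, ∀ K₁ K₂, cs.IsChamber K₁ → cs.IsChamber K₂ → c s ∈ K₁ → c s ∈ K₂ →
      Relation.ReflTransGen (fun K K' => ∃ a, cs.Adj a K K') K₁ K₂ := by
    intro s K₁ K₂ h₁ h₂ hs₁ hs₂
    rcases eq_or_exists_adj h₁ h₂ hs₁ hs₂ (hgen s) with rfl | h
    · exact .refl
    · exact .single h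
  let : Fintype {K // cs.IsChamber K} := (finite_chambers (cs := cs)).fintype
  refine interval_chain (ι := {K // cs.IsChamber K})
    (R := fun s t => ∀ K₁ K₂, cs.IsChamber K₁ → cs.IsChamber K₂ → c s ∈ K₁ → c t ∈ K₂ →
      Relation.ReflTransGen (fun K K' => ∃ a, cs.Adj a K K') K₁ K₂) (fun K => c ⁻¹' K.1)
    (fun K => K.2.isClosed.preimage hcont) ?_ (b := 1)
    Finset.univ 0 zero_le_one ?_ ?_ _ _ ⟨v, hv, rfl⟩ hK'
    (by simpa [hc] using self_mem_cone v) (by simpa [hc] using hw)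
  · intro x y z _ _ hxy hyz K₁ K₃ h₁ h₃ hx hz
    obtain ⟨K₂, h₂, hy⟩ := exists_mem_chamber (cs := cs) (c y)
    exact (hxy K₁ K₂ h₁ h₂ hx hy).trans (hyz K₂ K₃ h₂ h₃ hy hz)
  · intro s _
    obtain ⟨K, hK, hs⟩ := exists_mem_chamber (cs := cs) (c s)
    exact mem_iUnion₂.2 ⟨⟨K, hK⟩, by simp, hs⟩
  · intro K _ x hx y hy _ _ _ K₁ K₂ h₁ h₂ hx₁ hy₂
    exact (hloc x K₁ K.1 h₁ K.2 hx₁ hx).trans (hloc y K.1 K₂ K.2 h₂ hy hy₂)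

end SphericalCoxeterSystem

section Asymptotic

variable {n : ℕ} {X : Type*} [MetricSpace X]

/-- The ray of `f` in direction `u` stays at bounded distance from that of `g` in direction
`v`. -/
def Asy (f : ModelSpace n → X) (u : ModelSpace n) (g : ModelSpace n → X) (v : ModelSpace n) :
    Prop :=
  ∃ R : ℝ, ∀ t : ℝ, 0 ≤ t → dist (f (t • u)) (g (t • v)) ≤ R

namespace Asy

variable {f g h : ModelSpace n → X} {u v w : ModelSpace n}

lemma rfl' (f : ModelSpace n → X) (u : ModelSpace n) : Asy f u f u :=
  ⟨0, fun t _ => by rw [dist_self]⟩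

lemma symm (h : Asy f u g v) : Asy g v f u := by
  obtain ⟨R, hR⟩ := h
  exact ⟨R, fun t ht => by rw [dist_comm]; exact hR t ht⟩

lemma trans (h₁ : Asy f u g v) (h₂ : Asy g v h w) : Asy f u h w := by
  obtain ⟨R, hR⟩ := h₁
  obtain ⟨Q, hQ⟩ := h₂
  exact ⟨R + Q, fun t ht => (dist_triangle _ _ _).trans (add_le_add (hR t ht) (hQ t ht))⟩

lemma comp_left {L : ModelSpace n ≃ₗᵢ[ℝ] ModelSpace n} (h : Asy f (L u) g v) :
    Asy (fun x => f (L x)) u g v := by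
  obtain ⟨R, hR⟩ := h
  exact ⟨R, fun t ht => by simpa using hR t ht⟩

lemma of_eq (hf : Isometry f) (hg : Isometry g) {x c : ModelSpace n}
    (h : ∀ t : ℝ, 0 ≤ t → f (x + t • u) = g (c + t • v)) : Asy f u g v := by
  refine ⟨‖x‖ + ‖c‖, fun t ht => ?_⟩
  refine (dist_triangle _ (f (x + t • u)) _).trans (add_le_add ?_ ?_)
  · rw [hf.dist_eq, dist_eq_norm]; simp
  · rw [h t ht, hg.dist_eq, dist_eq_norm]; simp

end Asy

lemma le_of_forall_mul_le {a b R : ℝ} (h : ∀ t : ℝ, 0 ≤ t → t * a ≤ t * b + R) : a ≤ b := by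
  by_contra! hlt
  have hab : 0 < a - b := sub_pos.2 hlt
  have := h ((|R| + 1) / (a - b)) (by positivity)
  have h2 : (|R| + 1) / (a - b) * (a - b) = |R| + 1 := div_mul_cancel₀ _ hab.ne'
  linarith [le_abs_self R]

lemma Asy.dist_le {f g : ModelSpace n → X} (hf : Isometry f) (hg : Isometry g)
    {u v u' v' : ModelSpace n} (h : Asy f u g v) (h' : Asy f u' g v') :
    dist u u' ≤ dist v v' := by
  obtain ⟨R, hR⟩ := h
  obtain ⟨Q, hQ⟩ := h'
  refine le_of_forall_mul_le (R := R + Q) fun t ht => ?_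
  have h1 : ∀ x y : ModelSpace n, t * dist x y = dist (t • x) (t • y) := fun x y => by
    rw [dist_smul₀, Real.norm_of_nonneg ht]
  rw [h1, h1, ← hf.dist_eq (t • u), ← hg.dist_eq (t • v)]
  have h2 := dist_triangle4 (f (t • u)) (g (t • v)) (g (t • v')) (f (t • u'))
  have h3 := hR t ht
  have h4 := hQ t ht
  rw [dist_comm] at h4
  linarith

lemma Asy.dist_eq {f g : ModelSpace n → X} (hf : Isometry f) (hg : Isometry g)
    {u v u' v' : ModelSpace n} (h : Asy f u g v) (h' : Asy f u' g v') :
    dist u u' = dist v v' :=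
  le_antisymm (h.dist_le hf hg h') (h.symm.dist_le hg hf h'.symm)

lemma Asy.eq {f : ModelSpace n → X} (hf : Isometry f) {u v : ModelSpace n} (h : Asy f u f v) :
    u = v := by
  have := h.dist_eq hf hf (Asy.rfl' f v)
  rwa [dist_self, dist_eq_zero] at this

end Asymptotic

namespace SphericalCoxeterSystem.IsChamber

variable {n : ℕ} {cs : SphericalCoxeterSystem n} {K : Set (ModelSpace n)}

lemma mem_of_norm_le (hK : cs.IsChamber K) {y : ModelSpace n} {R : ℝ}
    (h : ∀ t : ℝ, 0 ≤ t → ∃ u ∈ K, ‖t • y - u‖ ≤ R) : y ∈ K := by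
  rw [← hK.isClosed.closure_eq, Metric.mem_closure_iff]
  intro ε hε
  have ht : 0 < (|R| + 1) / ε := by positivity
  set t := (|R| + 1) / ε with htdef
  obtain ⟨u, hu, hR⟩ := h t ht.le
  refine ⟨t⁻¹ • u, hK.smul_mem hu (inv_nonneg.2 ht.le), ?_⟩
  have h1 : t • y - u = t • (y - t⁻¹ • u) := by
    rw [smul_sub, smul_smul, mul_inv_cancel₀ ht.ne', one_smul]
  rw [h1, norm_smul, Real.norm_of_nonneg ht.le] at hR
  rw [dist_eq_norm]
  have h2 : t * ε = |R| + 1 := div_mul_cancel₀ _ hε.ne'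
  have h3 := le_abs_self R
  refine lt_of_mul_lt_mul_left (lt_of_le_of_lt hR ?_) ht.le
  linarith

end SphericalCoxeterSystem.IsChamber

namespace RBuilding

open SphericalCoxeterSystem

variable {n : ℕ} {cs : SphericalCoxeterSystem n} {X : Type*} [MetricSpace X] {Λ : Set X}
  (B : RBuilding cs X Λ) {f g : ModelSpace n → X} {K K' : Set (ModelSpace n)}

lemma comp_mem (hf : f ∈ B.charts) {L : ModelSpace n ≃ₗᵢ[ℝ] ModelSpace n} (hL : cs.IsLin L) :
    (fun x => f (L x)) ∈ B.charts := by
  have := B.A1 f hf _ (affine_mem_W hL 0)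
  convert this using 1
  ext x
  simp

lemma exists_transition (hf : f ∈ B.charts) (hg : g ∈ B.charts) :
    ∃ L, cs.IsLin L ∧ ∃ b, ∀ x, f x ∈ range g → f x = g (L x + b) := by
  obtain ⟨-, -, w, hw, h⟩ := B.A2 f hf g hg
  obtain ⟨L, hL, b, hb⟩ := exists_affine_of_mem_W hw
  exact ⟨L, hL, b, fun x hx => by rw [h x hx, hb]⟩

lemma eq_translate_of_subsector (hf : f ∈ B.charts) (hK : cs.IsChamber K) {T : Set X}
    (hT : IsSector cs B.charts T) (hsub : T ⊆ f '' K) :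
    ∃ z, T = (fun k => f (z + k)) '' K := by
  obtain ⟨_, g, hg, x, s, hs, rfl, rfl⟩ := hT
  obtain ⟨K₁, hK₁, rfl⟩ := isModelSector_iff.1 hs
  obtain ⟨L, hL, b, hLb⟩ := B.exists_transition hg hf
  have key : ∀ k ∈ K₁, g (x + k) = f (L x + b + L k) := by
    intro k hk
    have hk' : g (x + k) ∈ g '' ((fun y => x + y) '' K₁) := ⟨_, ⟨k, hk, rfl⟩, rfl⟩
    rw [hLb _ (image_subset_range _ _ (hsub hk')), map_add]
    congr 1; abel
  have hmem : ∀ k ∈ K₁, L x + b + L k ∈ K := by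
    intro k hk
    have hk' : g (x + k) ∈ g '' ((fun y => x + y) '' K₁) := ⟨_, ⟨k, hk, rfl⟩, rfl⟩
    obtain ⟨y, hy, he⟩ := hsub hk'
    rw [key k hk] at he
    rwa [← (B.isom f hf).injective he]
  have hLK : L '' K₁ = K := by
    refine (hK₁.map hL).eq_of_subset hK ?_
    rintro _ ⟨k, hk, rfl⟩
    refine hK.mem_of_norm_le (R := ‖L x + b‖) fun t ht =>
      ⟨_, hmem _ (hK₁.smul_mem hk ht), ?_⟩
    rw [map_smul, sub_add_cancel_right, norm_neg]
  refine ⟨L x + b, ?_⟩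
  ext p
  constructor
  · rintro ⟨_, ⟨k, hk, rfl⟩, rfl⟩
    exact ⟨L k, hLK ▸ ⟨k, hk, rfl⟩, (key k hk).symm⟩
  · rintro ⟨_, hk, rfl⟩
    rw [← hLK] at hk
    obtain ⟨k, hk, rfl⟩ := hk
    exact ⟨x + k, ⟨k, hk, rfl⟩, key k hk⟩

lemma isSector_image (hf : f ∈ B.charts) (hK : cs.IsChamber K) : IsSector cs B.charts (f '' K) :=
  ⟨_, f, hf, 0, K, isModelSector_iff.2 ⟨K, hK, by simp⟩, rfl, rfl⟩

lemma exists_common_chart (hf : f ∈ B.charts) (hg : g ∈ B.charts) (hK : cs.IsChamber K)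
    (hK' : cs.IsChamber K') :
    ∃ h ∈ B.charts, ∃ L₁, cs.IsLin L₁ ∧ ∃ L₂, cs.IsLin L₂ ∧ ∃ x₁ c₁ x₂ c₂,
      (∀ k ∈ K, f (x₁ + k) = h (c₁ + L₁ k)) ∧ ∀ k ∈ K', g (x₂ + k) = h (c₂ + L₂ k) := by
  obtain ⟨T₁, T₂, h, hh, hT₁, hT₂, hs₁, hs₂, hr₁, hr₂⟩ :=
    B.A4 _ _ (B.isSector_image hf hK) (B.isSector_image hg hK')
  obtain ⟨x₁, hx₁⟩ := B.eq_translate_of_subsector hf hK hT₁ hs₁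
  obtain ⟨x₂, hx₂⟩ := B.eq_translate_of_subsector hg hK' hT₂ hs₂
  obtain ⟨L₁, hL₁, b₁, h₁⟩ := B.exists_transition hf hh
  obtain ⟨L₂, hL₂, b₂, h₂⟩ := B.exists_transition hg hh
  refine ⟨h, hh, L₁, hL₁, L₂, hL₂, x₁, L₁ x₁ + b₁, x₂, L₂ x₂ + b₂, fun k hk => ?_, fun k hk => ?_⟩
  · rw [h₁ _ (hr₁ (by rw [hx₁]; exact ⟨k, hk, rfl⟩)), map_add]
    congr 1; abel
  · rw [h₂ _ (hr₂ (by rw [hx₂]; exact ⟨k, hk, rfl⟩)), map_add]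
    congr 1; abel

lemma asy_of_translate {h : ModelSpace n → X} (hf : f ∈ B.charts) (hh : h ∈ B.charts)
    (hK : cs.IsChamber K) {L : ModelSpace n ≃ₗᵢ[ℝ] ModelSpace n} {x c : ModelSpace n}
    (hfh : ∀ k ∈ K, f (x + k) = h (c + L k)) {k : ModelSpace n} (hk : k ∈ K) : Asy f k h (L k) :=
  Asy.of_eq (B.isom f hf) (B.isom h hh) fun t ht => by
    rw [hfh _ (hK.smul_mem hk ht), map_smul]

/-- Two chambers at infinity lie in a common apartment. -/
lemma exists_chart_asy (hf : f ∈ B.charts) (hg : g ∈ B.charts) (hK : cs.IsChamber K)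
    (hK' : cs.IsChamber K') :
    ∃ h ∈ B.charts, (∀ k ∈ K, Asy f k h k) ∧ ∃ L, cs.IsLin L ∧ ∀ k ∈ K', Asy g k h (L k) := by
  obtain ⟨h, hh, L₁, hL₁, L₂, hL₂, x₁, c₁, x₂, c₂, h₁, h₂⟩ := B.exists_common_chart hf hg hK hK'
  refine ⟨fun x => h (L₁ x), B.comp_mem hh hL₁, fun k hk => ?_, L₂.trans L₁.symm,
    hL₂.trans hL₁.symm, fun k hk => ?_⟩
  · exact (Asy.comp_left (B.asy_of_translate hf hh hK h₁ hk).symm).symm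
  · refine (Asy.comp_left ?_).symm
    simpa using (B.asy_of_translate hg hh hK' h₂ hk).symm

/-- Charts that are asymptotic on a chamber agree, up to a translation, on a set absorbing the
chamber. -/
lemma exists_translation (hf : f ∈ B.charts) (hg : g ∈ B.charts) (hK : cs.IsChamber K)
    (h : ∀ k ∈ K, Asy f k g k) :
    (∃ x₀, f x₀ ∈ range g) ∧ (∃ c, ∀ x, f x ∈ range g → f x = g (x + c)) ∧
      ∀ z, f z ∈ range g → ∀ k ∈ K, f (z + k) ∈ range g := by
  obtain ⟨e, he, L₁, hL₁, L₂, hL₂, x₁, c₁, x₂, c₂, h₁, h₂⟩ := B.exists_common_chart hf hg hK hK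
  have hL : ∀ x, L₁ x = L₂ x := hK.linear_ext fun k hk => Asy.eq (B.isom e he)
    ((B.asy_of_translate hf he hK h₁ hk).symm.trans
      ((h k hk).trans (B.asy_of_translate hg he hK h₂ hk)))
  obtain ⟨p, hp, q, hq, hpq⟩ := hK.exists_sub (L₂.symm (c₁ - c₂))
  have htail : ∀ k ∈ K, f (x₁ + q + k) = g (x₂ + p + k) := by
    intro k hk
    rw [add_assoc, add_assoc, h₁ _ (hK.add_mem hq hk), h₂ _ (hK.add_mem hp hk), hL]
    congr 1
    have : c₁ - c₂ = L₂ p - L₂ q := by rw [← map_sub, ← hpq, L₂.apply_symm_apply]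
    rw [map_add, map_add]
    rw [sub_eq_iff_eq_add] at this
    rw [this]; abel
  have hrange : ∀ k ∈ K, f (x₁ + q + k) ∈ range g := fun k hk => ⟨_, (htail k hk).symm⟩
  obtain ⟨hclosed, hconv, -⟩ := B.A2 f hf g hg
  refine ⟨⟨_, hrange 0 hK.zero_mem⟩, ?_, fun z hz k hk => ?_⟩
  · obtain ⟨M, hM, b, hb⟩ := B.exists_transition hf hg
    have hMk : ∀ k ∈ K, M (x₁ + q + k) + b = x₂ + p + k := fun k hk =>
      (B.isom g hg).injective ((hb _ (hrange k hk)).symm.trans (htail k hk))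
    have hid : ∀ x, M x = LinearIsometryEquiv.refl ℝ (ModelSpace n) x :=
      hK.linear_ext fun k hk => by
        have h1 := hMk k hk
        have h2 := hMk 0 hK.zero_mem
        rw [map_add] at h1
        rw [add_zero, add_zero] at h2
        rw [← h2, add_right_comm] at h1
        exact add_left_cancel h1
    exact ⟨b, fun x hx => by rw [hb x hx, hid]; rfl⟩
  · have hc : Tendsto (fun t : ℝ => z + k + t • (x₁ + q - z)) (𝓝[>] 0) (𝓝 (z + k)) := by
      have : ContinuousAt (fun t : ℝ => z + k + t • (x₁ + q - z)) 0 := by fun_prop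
      simpa using this.tendsto.mono_left nhdsWithin_le_nhds
    refine hclosed.mem_of_tendsto hc ?_
    filter_upwards [Ioc_mem_nhdsGT (zero_lt_one' ℝ)] with t ht
    have h1 := hconv hz (hrange (t⁻¹ • k) (hK.smul_mem hk (inv_nonneg.2 ht.1.le)))
      (sub_nonneg.2 ht.2) ht.1.le (by ring)
    have h2 : z + k + t • (x₁ + q - z) = (1 - t) • z + t • (x₁ + q + t⁻¹ • k) := by
      rw [smul_add t (x₁ + q), smul_smul, mul_inv_cancel₀ ht.1.ne']
      module
    rw [h2]
    exact h1

/-- `v` is the image of the direction `u` of `g` under the retraction of the building at infinity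
onto the apartment of `f` centred at the chamber `K`. -/
def IsRho (f : ModelSpace n → X) (K : Set (ModelSpace n)) (g : ModelSpace n → X)
    (u v : ModelSpace n) : Prop :=
  ∃ h ∈ B.charts, (∀ k ∈ K, Asy f k h k) ∧ Asy g u h v

variable {B}

lemma IsRho.unique (hK : cs.IsChamber K) {u v v' : ModelSpace n} (h : B.IsRho f K g u v)
    (h' : B.IsRho f K g u v') : v = v' := by
  obtain ⟨e, he, hfe, hge⟩ := h
  obtain ⟨e', he', hfe', hge'⟩ := h'
  exact hK.eq_of_dist_eq fun k hk => ((hfe k hk).symm.trans (hfe' k hk)).dist_eq (B.isom e he)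
    (B.isom e' he') (hge.symm.trans hge')

lemma exists_isRho_linear (hf : f ∈ B.charts) (hg : g ∈ B.charts) (hK : cs.IsChamber K)
    (hK' : cs.IsChamber K') : ∃ L, cs.IsLin L ∧ ∀ u ∈ K', B.IsRho f K g u (L u) := by
  obtain ⟨h, hh, h₁, L, hL, h₂⟩ := B.exists_chart_asy hf hg hK hK'
  exact ⟨L, hL, fun u hu => ⟨h, hh, h₁, h₂ u hu⟩⟩

lemma IsRho.dist_le (hf : f ∈ B.charts) (hg : g ∈ B.charts) (hK : cs.IsChamber K)
    {u v u' v' : ModelSpace n} (h : B.IsRho f K g u v) (h' : B.IsRho f K g u' v') :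
    dist v v' ≤ dist u u' := by
  classical
  set c : ℝ → ModelSpace n := fun s => u + s • (u' - u) with hc
  have hcont : Continuous c := by fun_prop
  let : Fintype {K // cs.IsChamber K} := (finite_chambers (cs := cs)).fintype
  have key := interval_chain (ι := {K // cs.IsChamber K})
    (R := fun s t => ∀ v v', B.IsRho f K g (c s) v → B.IsRho f K g (c t) v' →
      dist v v' ≤ (t - s) * dist u u') (fun K => c ⁻¹' K.1)
    (fun K => K.2.isClosed.preimage hcont) (fun x y z _ _ hxy hyz v v'' hv hv'' => ?_) (b := 1)
    Finset.univ 0 zero_le_one (fun s _ => ?_) (fun K' _ x hx y hy _ hxy _ v v' hv hv' => ?_) v v'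
    (by simpa [hc] using h) (by simpa [hc] using h')
  · simpa using key
  · obtain ⟨K', hK', hy⟩ := exists_mem_chamber (cs := cs) (c y)
    obtain ⟨L, -, hL⟩ := exists_isRho_linear hf hg hK hK'
    have h1 := hxy _ _ hv (hL _ hy)
    have h2 := hyz _ _ (hL _ hy) hv''
    have h3 := dist_triangle v (L (c y)) v''
    linarith
  · obtain ⟨K', hK', hs⟩ := exists_mem_chamber (cs := cs) (c s)
    exact mem_iUnion₂.2 ⟨⟨K', hK'⟩, by simp, hs⟩
  · obtain ⟨L, -, hL⟩ := exists_isRho_linear hf hg hK K'.2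
    rw [hv.unique hK (hL _ hx), hv'.unique hK (hL _ hy), L.dist_map, dist_eq_norm,
      show c x - c y = (x - y) • (u' - u) by simp only [hc, sub_smul]; abel, norm_smul,
      Real.norm_eq_abs, abs_sub_comm, abs_of_nonneg (sub_nonneg.2 hxy), dist_comm, dist_eq_norm]

end RBuilding

lemma eq_of_dist_neg_le {n : ℕ} {u v : ModelSpace n} (h : ‖v‖ = ‖u‖)
    (h' : dist u (-u) ≤ dist v (-u)) : v = u := by
  rw [dist_eq_norm, dist_eq_norm, sub_neg_eq_add, sub_neg_eq_add, ← two_smul ℝ u, norm_smul,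
    Real.norm_two] at h'
  have h1 := parallelogram_law_with_norm ℝ v u
  have h2 : ‖v - u‖ * ‖v - u‖ ≤ 0 := by
    rw [h] at h1
    nlinarith [norm_nonneg u, norm_nonneg (v + u)]
  have h3 : ‖v - u‖ = 0 := mul_self_eq_zero.1 (le_antisymm h2 (mul_self_nonneg _))
  exact sub_eq_zero.1 (norm_eq_zero.1 h3)

namespace RBuilding

open SphericalCoxeterSystem

variable {n : ℕ} {cs : SphericalCoxeterSystem n} {X : Type*} [MetricSpace X] {Λ : Set X}
  (B : RBuilding cs X Λ) {f g : ModelSpace n → X} {K K' : Set (ModelSpace n)} {a : ModelSpace n}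

lemma asy_of_asy_neg (hf : f ∈ B.charts) (hg : g ∈ B.charts) (hadj : cs.Adj a K K')
    (hneg : ∀ u ∈ K', Asy f (-u) g (-u)) (hQ : ∀ q ∈ K ∩ K', Asy f q g q) {k : ModelSpace n}
    (hk : k ∈ K) : Asy f k g k := by
  have hK := hadj.chamber
  obtain ⟨L, hL, hρ⟩ := exists_isRho_linear hf hg hK hK
  have hLQ : ∀ q ∈ K ∩ K', L q = q := fun q hq =>
    (hρ q hq.1).unique hK ⟨f, hf, fun k _ => Asy.rfl' f k, (hQ q hq).symm⟩
  rcases hadj.eq_id_or_reflIn L hLQ with h | h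
  · obtain ⟨e, he, hfe, hge⟩ := hρ k hk
    rw [h] at hge
    exact (hfe k hk).trans hge.symm
  · exfalso
    obtain ⟨v, hv, hpos⟩ := hadj.pos
    have h1 := hρ v hv
    rw [h] at h1
    have h2 : B.IsRho f K g (-reflIn a v) (-reflIn a v) :=
      ⟨f, hf, fun k _ => Asy.rfl' f k, (hneg _ (hadj.reflIn_mem hv)).symm⟩
    have h3 := eq_of_dist_neg_le (LinearIsometryEquiv.norm_map _ _).symm (h1.dist_le hf hg hK h2)
    rw [(reflIn_eq_self_iff hadj.mem.1 v).1 h3.symm] at hpos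
    exact hpos.false

/-- An apartment sharing a half of its boundary with another one either lies in it or meets it in a
half-apartment. -/
lemma exists_half (hf : f ∈ B.charts) (hg : g ∈ B.charts) (hadj : cs.Adj a K K')
    (hneg : ∀ u ∈ K', Asy f (-u) g (-u)) (hQ : ∀ q ∈ K ∩ K', Asy f q g q) :
    (∀ x, f x ∈ range g) ∨ ∃ c : ℝ, ∀ x, f x ∈ range g ↔ c ≤ inner ℝ a x := by
  obtain ⟨⟨x₀, hx₀⟩, -, hpos⟩ := B.exists_translation hf hg hadj.chamber
    fun k hk => B.asy_of_asy_neg hf hg hadj hneg hQ hk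
  obtain ⟨-, -, hneg'⟩ := B.exists_translation hf hg hadj.chamber'.neg
    (by rintro _ ⟨u, hu, rfl⟩; exact hneg u hu)
  have habs : ∀ z, f z ∈ range g → ∀ y, (0 : ℝ) ≤ inner ℝ a y → f (z + y) ∈ range g := by
    intro z hz y hy
    obtain ⟨v, hv, hv0⟩ := hadj.pos
    set s : ℝ := inner ℝ a y / inner ℝ a v with hs
    obtain ⟨q₁, h₁, q₂, h₂, hq⟩ := hadj.panel (y - s • v) (by
      rw [inner_sub_right, inner_smul_right, hs, div_mul_cancel₀ _ hv0.ne', sub_self])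
    have hdec : z + y = z + (s • v + q₁) + -q₂ := by
      rw [← sub_eq_add_neg, add_sub_assoc, add_sub_assoc, ← hq]; abel
    rw [hdec]
    exact hneg' _ (hpos _ hz _ (hadj.chamber.add_mem
      (hadj.chamber.smul_mem hv (div_nonneg hy hv0.le)) h₁.1)) _ ⟨q₂, h₂.2, rfl⟩
  have hup : ∀ x, f x ∈ range g → ∀ y, (inner ℝ a x : ℝ) ≤ inner ℝ a y → f y ∈ range g := by
    intro x hx y hxy
    have := habs x hx (y - x) (by rw [inner_sub_right]; exact sub_nonneg.2 hxy)
    rwa [add_sub_cancel] at this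
  set S : Set ℝ := (fun x => (inner ℝ a x : ℝ)) '' {x | f x ∈ range g} with hS
  by_cases hbdd : BddBelow S
  · right
    refine ⟨sInf S, fun y => ⟨fun hy => csInf_le hbdd ⟨y, hy, rfl⟩, fun hy => ?_⟩⟩
    obtain ⟨hclosed, -, -⟩ := B.A2 f hf g hg
    have hc : Tendsto (fun t : ℝ => y + t • a) (𝓝[>] 0) (𝓝 y) := by
      have : ContinuousAt (fun t : ℝ => y + t • a) 0 := by fun_prop
      simpa using this.tendsto.mono_left nhdsWithin_le_nhds
    refine hclosed.mem_of_tendsto hc ?_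
    filter_upwards [self_mem_nhdsWithin] with t ht
    have ht : 0 < t := ht
    have hlt : sInf S < inner ℝ a (y + t • a) := by
      rw [inner_add_right, inner_smul_right, real_inner_self_eq_norm_sq, hadj.mem.1]
      linarith
    obtain ⟨_, ⟨x, hx, rfl⟩, hxlt⟩ := exists_lt_of_csInf_lt (⟨_, x₀, hx₀, rfl⟩ : S.Nonempty) hlt
    exact hup x hx _ hxlt.le
  · left
    intro y
    rw [not_bddBelow_iff] at hbdd
    obtain ⟨_, ⟨x, hx, rfl⟩, hxlt⟩ := hbdd (inner ℝ a y)
    exact hup x hx y hxlt.le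

lemma isHalfApartment_inter (hf : f ∈ B.charts) (ha : a ∈ cs.roots) {c : ℝ}
    (h : ∀ x, f x ∈ range g ↔ c ≤ inner ℝ a x) :
    IsHalfApartment cs B.charts (range f ∩ range g) := by
  refine ⟨f, hf, _, _, isModelHalf_iff.2 ⟨a, ha, c • a, rfl, rfl⟩, ?_⟩
  have hx : ∀ x, (0 : ℝ) ≤ inner ℝ a (x - c • a) ↔ f x ∈ range g := fun x => by
    rw [h, inner_sub_right, inner_smul_right, real_inner_self_eq_norm_sq, ha.1, one_pow, mul_one,
      sub_nonneg]
  ext p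
  constructor
  · rintro ⟨⟨x, rfl⟩, hp⟩
    exact ⟨x, (hx x).2 hp, rfl⟩
  · rintro ⟨x, hp, rfl⟩
    exact ⟨⟨x, rfl⟩, (hx x).1 hp⟩

/-- Given two apartments sharing the chamber `K` at infinity, there is an apartment containing the
neighbour `K'` of `K` in the second and the chamber opposite to `K'` in the first. -/
lemma exists_chart_opposite (hf : f ∈ B.charts) (hg : g ∈ B.charts) (hK : cs.IsChamber K)
    (hK' : cs.IsChamber K') (hfg : ∀ k ∈ K, Asy f k g k) :
    ∃ h ∈ B.charts, (∀ u ∈ K', Asy g u h u) ∧ ∀ u ∈ K', Asy f (-u) h (-u) := by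
  obtain ⟨h, hh, hfh, L, hL, hgh⟩ := B.exists_chart_asy hf hg hK'.neg hK'
  have hneg : ∀ u ∈ K', Asy f (-u) h (-u) := fun u hu => hfh _ ⟨u, hu, rfl⟩
  refine ⟨h, hh, fun u hu => ?_, hneg⟩
  have h1 : B.IsRho f K h (L u) u := ⟨g, hg, hfg, (hgh u hu).symm⟩
  have h2 : B.IsRho f K h (-u) (-u) := ⟨f, hf, fun k _ => Asy.rfl' f k, (hneg u hu).symm⟩
  have h3 := eq_of_dist_neg_le (L.norm_map u) (h1.dist_le hf hh hK h2)
  have := hgh u hu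
  rwa [h3] at this

/-- If two apartments share the chamber `K` at infinity, then the first one is covered by two
apartments that share with the second one the chamber `K'` adjacent to `K`. -/
lemma exists_cover_of_adj (hf : f ∈ B.charts) (hg : g ∈ B.charts) (hadj : cs.Adj a K K')
    (hfg : ∀ k ∈ K, Asy f k g k) :
    ∃ b₁ ∈ B.charts, ∃ b₂ ∈ B.charts, (∀ u ∈ K', Asy g u b₁ u) ∧ (∀ u ∈ K', Asy g u b₂ u) ∧
      ∀ x, f x ∈ range b₁ ∨ f x ∈ range b₂ := by
  have hK := hadj.chamber
  have hK' := hadj.chamber'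
  have ha := hadj.mem
  obtain ⟨b₁, hb₁, hgb₁, hfb₁⟩ := B.exists_chart_opposite hf hg hK hK' hfg
  obtain ⟨h, hh, hfh, L, hL, hgh⟩ := B.exists_chart_asy hf hg hK' hK'
  have hLQ : ∀ q ∈ K ∩ K', L q = q := fun q hq => Asy.eq (B.isom h hh)
    ((hgh q hq.2).symm.trans ((hfg q hq.1).symm.trans (hfh q hq.2)))
  rcases hadj.eq_id_or_reflIn L hLQ with hid | hrefl
  · have hgf : ∀ u ∈ K', Asy g u f u := fun u hu => by
      have := hgh u hu
      rw [hid] at this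
      exact this.trans (hfh u hu).symm
    exact ⟨f, hf, f, hf, hgf, hgf, fun x => Or.inl ⟨x, rfl⟩⟩
  obtain ⟨e, he, hhe, hfe⟩ := B.exists_chart_opposite hf hh hK' hK hfh
  set b₂ : ModelSpace n → X := fun x => e (reflIn a x) with hb₂def
  have hb₂ : b₂ ∈ B.charts := B.comp_mem he (isLin_reflIn ha)
  have hrange : range b₂ = range e := (reflIn a).surjective.range_comp e
  have hgb₂ : ∀ u ∈ K', Asy g u b₂ u := fun u hu => by
    have := hgh u hu
    rw [hrefl] at this
    exact (Asy.comp_left (this.trans (hhe _ (hadj.mem_iff.1 hu))).symm).symm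
  refine ⟨b₁, hb₁, b₂, hb₂, hgb₁, hgb₂, ?_⟩
  rcases B.exists_half hf hb₁ hadj hfb₁
    (fun q hq => (hfg q hq.1).trans (hgb₁ q hq.2)) with h₁ | ⟨c₁, h₁⟩
  · exact fun x => Or.inl (h₁ x)
  rcases B.exists_half hf he hadj.symm hfe
    (fun q hq => (hfh q hq.1).trans (hhe q hq.2)) with h₂ | ⟨c₂, h₂⟩
  · exact fun x => Or.inr (hrange ▸ h₂ x)
  have hc : c₁ ≤ -c₂ := by
    have hhalf := B.exists_half hb₁ hb₂ hadj.neg ?_ ?_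
    · rcases hhalf with h₃ | ⟨c₃, h₃⟩
      · have hin : (inner ℝ a (c₁ • a) : ℝ) = c₁ := by
          rw [inner_smul_right, real_inner_self_eq_norm_sq, ha.1, one_pow, mul_one]
        obtain ⟨y, hy⟩ := (h₁ (c₁ • a)).2 hin.ge
        have h4 := h₃ y
        rw [hy, hrange, h₂, inner_neg_left, hin] at h4
        linarith
      · rw [hrange] at h₃
        obtain ⟨p, ⟨⟨x, rfl⟩, hp₁⟩, hp₂⟩ := B.A5 f hf b₁ hb₁ e he
          (B.isHalfApartment_inter hf ha h₁)
          (B.isHalfApartment_inter hb₁ (neg_mem_roots ha) h₃)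
          (B.isHalfApartment_inter hf (neg_mem_roots ha) h₂)
        have h4 := (h₁ x).1 hp₁
        have h5 := (h₂ x).1 hp₂
        rw [inner_neg_left] at h5
        linarith
    · rintro _ ⟨u, hu, rfl⟩
      simp only [neg_neg]
      exact (hgb₁ u hu).symm.trans (hgb₂ u hu)
    · rintro _ ⟨⟨q, hq, rfl⟩, ⟨q', hq', hqq⟩⟩
      obtain rfl : q' = q := neg_injective hqq
      have hr : reflIn a (-q') = -q' := by
        rw [map_neg, reflIn_of_orthogonal ha.1 (hadj.inner_eq_zero ⟨hq, hq'⟩)]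
      have h6 := hfe q' hq
      rw [← hr] at h6
      have h7 := (Asy.comp_left h6.symm).symm
      rw [hr] at h7
      exact (hfb₁ q' hq').symm.trans h7
  intro x
  rcases le_total c₁ (inner ℝ a x) with h | h
  · exact Or.inl ((h₁ x).2 h)
  · right
    rw [hrange, h₂, inner_neg_left]
    linarith

lemma exists_finite_cover_of_gallery (hg : g ∈ B.charts)
    (hgal : Relation.ReflTransGen (fun K K' => ∃ a, cs.Adj a K K') K K') :
    ∀ f ∈ B.charts, (∀ k ∈ K, Asy f k g k) →
      ∃ S : Set (ModelSpace n → X), S.Finite ∧ S ⊆ B.charts ∧ (∀ h ∈ S, ∀ u ∈ K', Asy g u h u) ∧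
        ∀ x, ∃ h ∈ S, f x ∈ range h := by
  induction hgal using Relation.ReflTransGen.head_induction_on with
  | refl =>
    exact fun f hf hfg => ⟨{f}, finite_singleton f, singleton_subset_iff.2 hf,
      by rintro _ rfl u hu; exact (hfg u hu).symm, fun x => ⟨f, rfl, x, rfl⟩⟩
  | head hadj _ ih =>
    intro f hf hfg
    obtain ⟨a, hadj⟩ := hadj
    obtain ⟨b₁, hb₁, b₂, hb₂, h₁, h₂, hcov⟩ := B.exists_cover_of_adj hf hg hadj hfg
    obtain ⟨S₁, hS₁, hsub₁, hasy₁, hc₁⟩ := ih b₁ hb₁ fun u hu => (h₁ u hu).symm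
    obtain ⟨S₂, hS₂, hsub₂, hasy₂, hc₂⟩ := ih b₂ hb₂ fun u hu => (h₂ u hu).symm
    refine ⟨S₁ ∪ S₂, hS₁.union hS₂, union_subset hsub₁ hsub₂, ?_, fun x => ?_⟩
    · rintro h (hh | hh)
      exacts [hasy₁ h hh, hasy₂ h hh]
    · rcases hcov x with ⟨y, hy⟩ | ⟨y, hy⟩
      · obtain ⟨h, hh, hr⟩ := hc₁ y
        exact ⟨h, Or.inl hh, hy ▸ hr⟩
      · obtain ⟨h, hh, hr⟩ := hc₂ y
        exact ⟨h, Or.inr hh, hy ▸ hr⟩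

/-- Every apartment is covered by finitely many apartments containing a given chamber at
infinity. -/
lemma exists_finite_cover (hf : f ∈ B.charts) (hg : g ∈ B.charts) (hK : cs.IsChamber K) :
    ∃ S : Set (ModelSpace n → X), S.Finite ∧ S ⊆ B.charts ∧ (∀ h ∈ S, ∀ u ∈ K, Asy g u h u) ∧
      ∀ x, ∃ h ∈ S, f x ∈ range h := by
  obtain ⟨e, he, hfe, L, hL, hge⟩ := B.exists_chart_asy hf hg hK hK
  obtain ⟨S, hS, hsub, hasy, hcov⟩ := B.exists_finite_cover_of_gallery he
    (reflTransGen_adj hK (hK.map hL)) f hf hfe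
  refine ⟨(fun h x => h (L x)) '' S, hS.image _, ?_, ?_, fun x => ?_⟩
  · rintro _ ⟨h, hh, rfl⟩
    exact B.comp_mem (hsub hh) hL
  · rintro _ ⟨h, hh, rfl⟩ u hu
    exact (Asy.comp_left ((hge u hu).trans (hasy h hh _ ⟨u, hu, rfl⟩)).symm).symm
  · obtain ⟨h, hh, y, hy⟩ := hcov x
    exact ⟨_, ⟨h, hh, rfl⟩, L.symm y, by simpa using hy⟩

end RBuilding

section Parallel

variable {X : Type*} [MetricSpace X] {S T U : Set X}

lemma par_iff : Par S T ↔ Metric.hausdorffEDist S T ≠ ⊤ := Iff.rfl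

lemma Par.exists_dist_le (h : Par S T) : ∃ R : ℝ, ∀ p ∈ S, ∃ q ∈ T, dist p q ≤ R := by
  refine ⟨((Metric.hausdorffEDist S T) + 1).toReal, fun p hp => ?_⟩
  obtain ⟨q, hq, hlt⟩ := Metric.exists_edist_lt_of_hausdorffEDist_lt hp
    (ENNReal.lt_add_right (par_iff.1 h) one_ne_zero)
  refine ⟨q, hq, ?_⟩
  rw [dist_edist]
  exact ENNReal.toReal_mono (ENNReal.add_ne_top.2 ⟨par_iff.1 h, ENNReal.one_ne_top⟩) hlt.le

lemma Par.trans (h : Par S T) (h' : Par T U) : Par S U :=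
  par_iff.2 (ne_top_of_le_ne_top (ENNReal.add_ne_top.2 ⟨par_iff.1 h, par_iff.1 h'⟩)
    Metric.hausdorffEDist_triangle)

lemma par_of_dist_le {R : ℝ} (h₁ : ∀ p ∈ S, ∃ q ∈ T, dist p q ≤ R)
    (h₂ : ∀ q ∈ T, ∃ p ∈ S, dist q p ≤ R) : Par S T := by
  have key : ∀ p q : X, dist p q ≤ R → edist p q ≤ ENNReal.ofReal R := fun p q h => by
    rw [edist_dist]; exact ENNReal.ofReal_le_ofReal h
  refine par_iff.2 (ne_top_of_le_ne_top (ENNReal.ofReal_ne_top (r := R))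
    (Metric.hausdorffEDist_le_of_mem_edist (fun p hp => ?_) fun q hq => ?_))
  · obtain ⟨q, hq, h⟩ := h₁ p hp
    exact ⟨q, hq, key _ _ h⟩
  · obtain ⟨p, hp, h⟩ := h₂ q hq
    exact ⟨p, hp, key _ _ h⟩

end Parallel

lemma SphericalCoxeterSystem.IsChamber.closedBall_smul_subset {n : ℕ}
    {cs : SphericalCoxeterSystem n} {K : Set (ModelSpace n)} (hK : cs.IsChamber K)
    {e : ModelSpace n} (he : Metric.closedBall e 1 ⊆ K) {d : ℝ} (hd : 0 ≤ d) :
    Metric.closedBall (d • e) d ⊆ K := by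
  rcases hd.eq_or_lt with rfl | hd
  · simpa using hK.zero_mem
  intro y hy
  have h1 : d⁻¹ • y ∈ Metric.closedBall e 1 := by
    have h2 : y - d • e = d • (d⁻¹ • y - e) := by
      rw [smul_sub, smul_smul, mul_inv_cancel₀ hd.ne', one_smul]
    rw [Metric.mem_closedBall, dist_eq_norm] at hy ⊢
    rw [h2, norm_smul, Real.norm_of_nonneg hd.le] at hy
    exact le_of_mul_le_mul_left (by linarith) hd
  have h2 := hK.smul_mem (he h1) hd.le
  rwa [smul_smul, mul_inv_cancel₀ hd.ne', one_smul] at h2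

namespace RBuilding

open SphericalCoxeterSystem

variable {n : ℕ} {cs : SphericalCoxeterSystem n} {X : Type*} [MetricSpace X] {Λ : Set X}
  (B : RBuilding cs X Λ) {f g : ModelSpace n → X} {K K' : Set (ModelSpace n)}

/-- A sector parallel to the sector of `g` over `K` is the sector over `K` of a chart asymptotic
to `g` on `K`. -/
lemma exists_aligned_chart (hg : g ∈ B.charts) (hK : cs.IsChamber K) {y : ModelSpace n}
    {β : X} {C : Set X} (hC : IsSectorAt cs B.charts β C)
    (hpar : Par C (g '' ((fun k => y + k) '' K))) :
    ∃ f ∈ B.charts, (∀ k ∈ K, Asy g k f k) ∧ ∃ x, f x = β ∧ C = (fun k => f (x + k)) '' K := by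
  obtain ⟨f, hf, x, s, hs, rfl, rfl⟩ := hC
  obtain ⟨K', hK', rfl⟩ := isModelSector_iff.1 hs
  obtain ⟨R, hR⟩ := hpar.exists_dist_le
  obtain ⟨h, hh, L₁, hL₁, L₂, hL₂, x₁, c₁, x₂, c₂, h₁, h₂⟩ := B.exists_common_chart hf hg hK' hK
  have hLK : L₁ '' K' = L₂ '' K := by
    refine (hK'.map hL₁).eq_of_subset (hK.map hL₂) ?_
    rintro _ ⟨k, hk, rfl⟩
    refine (hK.map hL₂).mem_of_norm_le (R := ‖x₁ - x‖ + R + ‖y - x₂‖ + ‖c₂ - c₁‖) fun t ht => ?_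
    obtain ⟨_, ⟨_, ⟨v, hv, rfl⟩, rfl⟩, hdist⟩ :=
      hR (f (x + t • k)) ⟨_, ⟨t • k, hK'.smul_mem hk ht, rfl⟩, rfl⟩
    refine ⟨L₂ v, ⟨v, hv, rfl⟩, ?_⟩
    have h3 : dist (f (x₁ + t • k)) (f (x + t • k)) = ‖x₁ - x‖ := by
      rw [(B.isom f hf).dist_eq, dist_add_right, dist_eq_norm]
    have h4 : dist (g (y + v)) (g (x₂ + v)) = ‖y - x₂‖ := by
      rw [(B.isom g hg).dist_eq, dist_add_right, dist_eq_norm]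
    have h5 := dist_triangle4 (f (x₁ + t • k)) (f (x + t • k)) (g (y + v)) (g (x₂ + v))
    rw [h3, h4, h₁ _ (hK'.smul_mem hk ht), h₂ _ hv, (B.isom h hh).dist_eq, dist_eq_norm,
      map_smul] at h5
    have h6 := norm_add_le (c₁ + t • L₁ k - (c₂ + L₂ v)) (c₂ - c₁)
    rw [show c₁ + t • L₁ k - (c₂ + L₂ v) + (c₂ - c₁) = t • L₁ k - L₂ v by abel] at h6
    linarith
  have hmem : ∀ {k}, k ∈ K → L₁.symm (L₂ k) ∈ K' := fun {k} hk => by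
    obtain ⟨k', hk', he⟩ : L₂ k ∈ L₁ '' K' := hLK ▸ ⟨k, hk, rfl⟩
    rwa [← he, L₁.symm_apply_apply]
  have hmem' : ∀ {k}, k ∈ K' → L₂.symm (L₁ k) ∈ K := fun {k} hk => by
    obtain ⟨k', hk', he⟩ : L₁ k ∈ L₂ '' K := hLK ▸ ⟨k, hk, rfl⟩
    rwa [← he, L₂.symm_apply_apply]
  have key : ∀ k, f (L₁.symm (L₂ (L₂.symm (L₁ x) + k))) = f (x + L₁.symm (L₂ k)) := fun k => by
    simp
  refine ⟨fun z => f (L₁.symm (L₂ z)), B.comp_mem hf (hL₂.trans hL₁.symm), fun k hk => ?_,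
    L₂.symm (L₁ x), by simp, ?_⟩
  · have h3 := B.asy_of_translate hg hh hK h₂ hk
    have h4 := B.asy_of_translate hf hh hK' h₁ (hmem hk)
    rw [L₁.apply_symm_apply] at h4
    exact (Asy.comp_left (L := L₂.trans L₁.symm) (h4.trans h3.symm)).symm
  · ext p
    constructor
    · rintro ⟨_, ⟨k, hk, rfl⟩, rfl⟩
      exact ⟨L₂.symm (L₁ k), hmem' hk, by simp⟩
    · rintro ⟨k, hk, rfl⟩
      exact ⟨_, ⟨_, hmem hk, rfl⟩, (key k).symm⟩

/-- `z` is the translate of `p` by `u` in an apartment containing the chamber `K` of `g` at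
infinity. -/
def IsTranslate (g : ModelSpace n → X) (K : Set (ModelSpace n)) (p : X) (u : ModelSpace n)
    (z : X) : Prop :=
  ∃ h ∈ B.charts, (∀ k ∈ K, Asy g k h k) ∧ ∃ a, h a = p ∧ h (a + u) = z

variable {B}

lemma IsTranslate.unique (hK : cs.IsChamber K) {p z z' : X} {u : ModelSpace n} (hu : u ∈ K)
    (h : B.IsTranslate g K p u z) (h' : B.IsTranslate g K p u z') : z = z' := by
  obtain ⟨f, hf, hgf, a, hfa, hz⟩ := h
  obtain ⟨f', hf', hgf', a', hfa', hz'⟩ := h'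
  obtain ⟨-, ⟨c, hc⟩, habs⟩ := B.exists_translation hf hf' hK
    fun k hk => (hgf k hk).symm.trans (hgf' k hk)
  have hr : f a ∈ range f' := ⟨a', hfa'.trans hfa.symm⟩
  have h1 : a' = a + c := (B.isom f' hf').injective ((hfa'.trans hfa.symm).trans (hc a hr))
  rw [← hz, ← hz', hc _ (habs a hr u hu), h1, add_right_comm]

/-- Translations by vectors deep inside the chamber are transported along a segment with an error
bounded by the length of the segment. -/
lemma exists_transport (hf : f ∈ B.charts) (hg : g ∈ B.charts) (hK : cs.IsChamber K)
    (p q : ModelSpace n) :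
    ∃ w : ModelSpace n, ‖w‖ ≤ dist p q ∧ ∀ u z, Metric.closedBall u (dist p q) ⊆ K →
      B.IsTranslate g K (f p) u z → B.IsTranslate g K (f q) (u + w) z := by
  classical
  obtain ⟨S, hS, hsub, hasy, hcov⟩ := B.exists_finite_cover hf hg hK
  set c : ℝ → ModelSpace n := fun s => p + s • (q - p) with hc
  have hcont : Continuous c := by fun_prop
  set d := dist p q with hd
  have hd0 : 0 ≤ d := dist_nonneg
  have hdist : ∀ s t, s ≤ t → dist (c s) (c t) = (t - s) * d := fun s t hst => by
    rw [hd, dist_comm p, dist_eq_norm, dist_eq_norm,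
      show c s - c t = (s - t) • (q - p) by simp only [hc, sub_smul]; abel, norm_smul,
      Real.norm_eq_abs, abs_sub_comm, abs_of_nonneg (sub_nonneg.2 hst)]
  let : Fintype S := hS.fintype
  have key := interval_chain (ι := S)
    (R := fun s t => ∃ w : ModelSpace n, ‖w‖ ≤ (t - s) * d ∧
      ∀ u z, Metric.closedBall u ((t - s) * d) ⊆ K →
        B.IsTranslate g K (f (c s)) u z → B.IsTranslate g K (f (c t)) (u + w) z)
    (fun h => {s | f (c s) ∈ range h.1})
    (fun h => (B.A2 f hf h.1 (hsub h.2)).1.preimage hcont)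
    (fun x y z hxy hyz h₁ h₂ => ?_) (b := 1) Finset.univ 0 zero_le_one (fun s _ => ?_)
    (fun h _ s hs t ht _ hst _ => ?_)
  · simpa [hc] using key
  · obtain ⟨w₁, hw₁, h₁⟩ := h₁
    obtain ⟨w₂, hw₂, h₂⟩ := h₂
    refine ⟨w₁ + w₂, (norm_add_le _ _).trans (by linarith), fun u v hu hv => ?_⟩
    rw [← add_assoc]
    have hxy' : 0 ≤ (y - x) * d := mul_nonneg (sub_nonneg.2 hxy) hd0
    have hyz' : 0 ≤ (z - y) * d := mul_nonneg (sub_nonneg.2 hyz) hd0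
    refine h₂ _ _ ((Metric.closedBall_subset_closedBall' ?_).trans hu) (h₁ u v
      ((Metric.closedBall_subset_closedBall ?_).trans hu) hv)
    · rw [dist_self_add_left]
      linarith
    · linarith
  · obtain ⟨h, hh, hr⟩ := hcov (c s)
    exact mem_iUnion₂.2 ⟨⟨h, hh⟩, Finset.mem_univ _, hr⟩
  · obtain ⟨a, ha⟩ := hs
    obtain ⟨b, hb⟩ := ht
    refine ⟨a - b, ?_, fun u z hu hz => ?_⟩
    · rw [← dist_eq_norm, ← (B.isom _ (hsub h.2)).dist_eq, ha, hb, (B.isom f hf).dist_eq,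
        hdist s t hst]
    · have huK : u ∈ K :=
        hu (Metric.mem_closedBall_self (mul_nonneg (sub_nonneg.2 hst) hd0))
      refine ⟨h.1, hsub h.2, hasy _ h.2, b, hb, ?_⟩
      rw [hz.unique hK huK ⟨h.1, hsub h.2, hasy _ h.2, a, ha, rfl⟩]
      show h.1 (b + (u + (a - b))) = h.1 (a + u)
      exact congrArg h.1 (by abel)

end RBuilding

universe u

/-- **Lemma 5.** There is a constant `k > 0` depending only on the
spherical Coxeter system such that: for any ℝ-building of that type, any chamber at
infinity `C_∞` (represented by a sector `C₀`), and any points `β`, `γ`, there is a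
point `δ` such that the sector `C_δ` is a subsector of both `C_β` and `C_γ` and
`d(β,δ), d(γ,δ) ≤ k·d(β,γ)`. -/
theorem exists_const_subsector
    {n : ℕ} (cs : SphericalCoxeterSystem n) :
    ∃ k : ℝ, 0 < k ∧
      ∀ (X : Type u) [MetricSpace X], ∀ (Λ : Set X) (B : RBuilding cs X Λ),
        ∀ C₀ : Set X, IsSector cs B.charts C₀ →
        ∀ β ∈ Λ, ∀ γ ∈ Λ, ∀ Cβ Cγ : Set X,
          IsSectorAt cs B.charts β Cβ → Par Cβ C₀ →
          IsSectorAt cs B.charts γ Cγ → Par Cγ C₀ →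
          ∃ δ ∈ Λ, ∃ Cδ : Set X, IsSectorAt cs B.charts δ Cδ ∧ Par Cδ C₀ ∧
            Cδ ⊆ Cβ ∧ Cδ ⊆ Cγ ∧
            dist β δ ≤ k * dist β γ ∧ dist γ δ ≤ k * dist β γ := by
  have hch : ∀ K, ∃ e, cs.IsChamber K → Metric.closedBall e 1 ⊆ K := fun K => by
    by_cases hK : cs.IsChamber K
    · obtain ⟨e, he⟩ := hK.exists_closedBall
      exact ⟨e, fun _ => he⟩
    · exact ⟨0, fun h => absurd h hK⟩
  choose e he using hch
  obtain ⟨M, hM⟩ := ((SphericalCoxeterSystem.finite_chambers (cs := cs)).image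
    fun K => ‖e K‖).bddAbove
  refine ⟨|M| + 1, by positivity, ?_⟩
  intro X _ Λ B C₀ hC₀ β hβ γ hγ Cβ Cγ hCβ hparβ hCγ hparγ
  obtain ⟨_, g, hg, y, s, hs, rfl, rfl⟩ := hC₀
  obtain ⟨K, hK, rfl⟩ := SphericalCoxeterSystem.isModelSector_iff.1 hs
  obtain ⟨fβ, hfβ, hgβ, x, rfl, rfl⟩ := B.exists_aligned_chart hg hK hCβ hparβ
  obtain ⟨fγ, hfγ, hgγ, x', rfl, rfl⟩ := B.exists_aligned_chart hg hK hCγ hparγ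
  obtain ⟨f, hf, ⟨p, hp⟩, ⟨q, hq⟩⟩ := B.A3 _ hβ _ hγ
  have hd : dist p q = dist (fβ x) (fγ x') := by rw [← hp, ← hq, (B.isom f hf).dist_eq]
  obtain ⟨w, hw, htrans⟩ := RBuilding.exists_transport hf hg hK p q
  rw [hd, hp, hq] at htrans
  rw [hd] at hw
  set d := dist (fβ x) (fγ x') with hd'
  have hd0 : 0 ≤ d := dist_nonneg
  have heM : ‖e K‖ ≤ |M| := (hM ⟨K, hK, rfl⟩).trans (le_abs_self M)
  have hball := hK.closedBall_smul_subset (he K hK) hd0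
  set u := d • e K with hu
  have hunorm : ‖u‖ = d * ‖e K‖ := by rw [hu, norm_smul, Real.norm_of_nonneg hd0]
  have huK : u ∈ K := hball (Metric.mem_closedBall_self hd0)
  have huw : u + w ∈ K := hball (by rwa [Metric.mem_closedBall, dist_self_add_left])
  have hδ : fγ (x' + (u + w)) = fβ (x + u) :=
    RBuilding.IsTranslate.unique hK huw ⟨fγ, hfγ, hgγ, x', rfl, rfl⟩
      (htrans u _ hball ⟨fβ, hfβ, hgβ, x, rfl, rfl⟩)
  have hsame : ∀ k ∈ K, fβ (x + u + k) = fγ (x' + (u + w) + k) := fun k hk =>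
    RBuilding.IsTranslate.unique hK hk ⟨fβ, hfβ, hgβ, x + u, rfl, rfl⟩
      ⟨fγ, hfγ, hgγ, x' + (u + w), hδ, rfl⟩
  refine ⟨fβ (x + u), B.into fβ hfβ ⟨_, rfl⟩, (fun k => fβ (x + u + k)) '' K,
    ⟨fβ, hfβ, x + u, _, SphericalCoxeterSystem.isModelSector_iff.2 ⟨K, hK, rfl⟩, rfl,
      (image_image _ _ _).symm⟩, Par.trans (par_of_dist_le (R := ‖u‖) ?_ ?_) hparβ, ?_, ?_, ?_, ?_⟩
  · rintro _ ⟨k, hk, rfl⟩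
    refine ⟨_, ⟨k, hk, rfl⟩, ?_⟩
    rw [(B.isom fβ hfβ).dist_eq, dist_add_right, dist_self_add_left]
  · rintro _ ⟨k, hk, rfl⟩
    refine ⟨_, ⟨k, hk, rfl⟩, ?_⟩
    rw [(B.isom fβ hfβ).dist_eq, dist_add_right, dist_self_add_right]
  · rintro _ ⟨k, hk, rfl⟩
    exact ⟨u + k, hK.add_mem huK hk, by simp only [add_assoc]⟩
  · rintro _ ⟨k, hk, rfl⟩
    exact ⟨u + w + k, hK.add_mem huw hk, by simpa only [add_assoc] using (hsame k hk).symm⟩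
  · rw [(B.isom fβ hfβ).dist_eq, dist_self_add_right, hunorm]
    nlinarith
  · rw [← hδ, (B.isom fγ hfγ).dist_eq, dist_self_add_right]
    refine (norm_add_le _ _).trans ?_
    rw [hunorm]
    nlinarith
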